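/- arXiv:2004.12355 — 2 statements merged into one kernel-verified Lean document; each statement's English description precedes it below -/
import Mathlib

section
/- Let (A,B) be a random vector with nonnegative coordinates satisfying P(A=1)<1, P(B=0)<1, E A^κ = 1 and E B^κ < ∞ for some κ>0, and let U be the unique-in-law solution of U =_d A U + B with U independent of (A,B). If E[A^κ ln⁺ A] < +∞, then, as t → ∞, E[U^κ 1{U ≤ t}] ≍ (E[(AU+B)^κ − (AU)^κ] / E[A^κ ln A]) · ln t. -/
open MeasureTheory ProbabilityTheory Filter Topology

section Tauberian

variable {Ω : Type*} [MeasurableSpace Ω] {μ : Measure Ω} {w L : Ω → ℝ} {c : ℝ}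

/-- Karamata's argument for polynomial test functions. -/
lemma tendsto_laplace_mul_polynomial
    (hint : ∀ ε > 0, Integrable (fun ω => w ω * Real.exp (-(ε * L ω))) μ)
    (hlim : Tendsto (fun ε => ε * ∫ ω, w ω * Real.exp (-(ε * L ω)) ∂μ) (𝓝[>] 0) (𝓝 c))
    (P : Polynomial ℝ) :
    (∀ ε > 0, Integrable
      (fun ω => w ω * Real.exp (-(ε * L ω)) * P.eval (Real.exp (-(ε * L ω)))) μ) ∧
    Tendsto (fun ε => ε * ∫ ω, w ω * Real.exp (-(ε * L ω)) *
        P.eval (Real.exp (-(ε * L ω))) ∂μ) (𝓝[>] 0) (𝓝 (c * ∫ x in (0 : ℝ)..1, P.eval x)) := by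
  induction P using Polynomial.induction_on' with
  | add P Q hP hQ =>
    refine ⟨fun ε hε => ?_, ?_⟩
    · simp only [Polynomial.eval_add, mul_add]
      exact (hP.1 ε hε).add (hQ.1 ε hε)
    · have hint_add : ∫ x in (0 : ℝ)..1, (P + Q).eval x
          = (∫ x in (0 : ℝ)..1, P.eval x) + ∫ x in (0 : ℝ)..1, Q.eval x := by
        simp only [Polynomial.eval_add]
        exact intervalIntegral.integral_add (P.continuous.intervalIntegrable _ _)
          (Q.continuous.intervalIntegrable _ _)
      rw [hint_add, mul_add]
      refine (hP.2.add hQ.2).congr' ?_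
      filter_upwards [self_mem_nhdsWithin] with ε hε
      rw [← mul_add, ← integral_add (hP.1 ε hε) (hQ.1 ε hε)]
      simp only [Polynomial.eval_add, mul_add]
  | monomial k a =>
    have hk : (0 : ℝ) < k + 1 := by positivity
    have key : ∀ ε : ℝ, (fun ω => w ω * Real.exp (-(ε * L ω)) *
        (Polynomial.monomial k a).eval (Real.exp (-(ε * L ω))))
        = fun ω => a * (w ω * Real.exp (-((k + 1) * ε * L ω))) := by
      intro ε
      funext ω
      have : Real.exp (-((k + 1) * ε * L ω))
          = Real.exp (-(ε * L ω)) * Real.exp (-(ε * L ω)) ^ k := by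
        rw [← Real.exp_nat_mul, ← Real.exp_add]
        ring_nf
      rw [this, Polynomial.eval_monomial]
      ring
    refine ⟨fun ε hε => ?_, ?_⟩
    · rw [key]
      exact (hint _ (mul_pos hk hε)).const_mul a
    · have hscale : Tendsto (fun ε : ℝ => ((k : ℝ) + 1) * ε) (𝓝[>] 0) (𝓝[>] 0) := by
        refine tendsto_nhdsWithin_iff.2 ⟨?_, ?_⟩
        · have : Tendsto (fun ε : ℝ => ((k : ℝ) + 1) * ε) (𝓝 0) (𝓝 (((k : ℝ) + 1) * 0)) :=
            (continuous_const.mul continuous_id).tendsto 0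
          rw [mul_zero] at this
          exact this.mono_left nhdsWithin_le_nhds
        · filter_upwards [self_mem_nhdsWithin] with ε hε
          exact mul_pos hk hε
      have h := (hlim.comp hscale).const_mul (a / (k + 1))
      have hI : ∫ x in (0 : ℝ)..1, (Polynomial.monomial k a).eval x = a / (k + 1) := by
        simp [Polynomial.eval_monomial, div_eq_mul_inv]
      rw [hI, mul_comm c]
      refine h.congr fun ε => ?_
      simp only [Function.comp_apply]
      rw [key, integral_const_mul]
      field_simp

/-- Karamata's argument for continuous test functions. -/
lemma tendsto_laplace_mul_continuous
    (hL : Measurable L) (hw0 : ∀ ω, 0 ≤ w ω) (hL0 : ∀ ω, 0 ≤ L ω)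
    (hint : ∀ ε > 0, Integrable (fun ω => w ω * Real.exp (-(ε * L ω))) μ)
    (hlim : Tendsto (fun ε => ε * ∫ ω, w ω * Real.exp (-(ε * L ω)) ∂μ) (𝓝[>] 0) (𝓝 c))
    {h : ℝ → ℝ} (hh : Continuous h) :
    (∀ ε > 0, Integrable
      (fun ω => w ω * Real.exp (-(ε * L ω)) * h (Real.exp (-(ε * L ω)))) μ) ∧
    Tendsto (fun ε => ε * ∫ ω, w ω * Real.exp (-(ε * L ω)) * h (Real.exp (-(ε * L ω))) ∂μ)
      (𝓝[>] 0) (𝓝 (c * ∫ x in (0 : ℝ)..1, h x)) := by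
  have hmem : ∀ ε > 0, ∀ ω, Real.exp (-(ε * L ω)) ∈ Set.Icc (0 : ℝ) 1 := fun ε hε ω =>
    ⟨(Real.exp_pos _).le, Real.exp_le_one_iff.2 (neg_nonpos.2 (mul_nonneg hε.le (hL0 ω)))⟩
  have hinth : ∀ ε > 0, Integrable
      (fun ω => w ω * Real.exp (-(ε * L ω)) * h (Real.exp (-(ε * L ω)))) μ := by
    intro ε hε
    obtain ⟨K, hK⟩ := isCompact_Icc.exists_bound_of_continuousOn
      (hh.continuousOn (s := Set.Icc (0 : ℝ) 1))
    refine (hint ε hε).mul_bdd (c := K) ?_ (ae_of_all _ fun ω => hK _ (hmem ε hε ω))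
    exact (hh.measurable.comp (by fun_prop)).aestronglyMeasurable
  refine ⟨hinth, Metric.tendsto_nhds.2 fun δ hδ => ?_⟩
  set η := δ / (3 * (|c| + 1)) with hη
  have hc1 : 0 < |c| + 1 := by positivity
  have hη0 : 0 < η := by positivity
  have hηc : η * (|c| + 1) = δ / 3 := by rw [hη]; field_simp
  obtain ⟨P, hP⟩ := exists_polynomial_near_of_continuousOn 0 1 h hh.continuousOn η hη0
  obtain ⟨hPint, hPlim⟩ := tendsto_laplace_mul_polynomial hint hlim P
  have hIdiff : |c * (∫ x in (0 : ℝ)..1, P.eval x) - c * ∫ x in (0 : ℝ)..1, h x| ≤ δ / 3 := by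
    rw [← mul_sub, ← intervalIntegral.integral_sub (P.continuous.intervalIntegrable _ _)
      (hh.intervalIntegrable _ _), abs_mul]
    have : ‖∫ x in (0 : ℝ)..1, (P.eval x - h x)‖ ≤ η * |1 - 0| := by
      refine intervalIntegral.norm_integral_le_of_norm_le_const fun x hx => ?_
      rw [Set.uIoc_of_le zero_le_one] at hx
      exact (hP x ⟨hx.1.le, hx.2⟩).le
    rw [sub_zero, abs_one, mul_one, Real.norm_eq_abs] at this
    nlinarith [abs_nonneg c]
  filter_upwards [self_mem_nhdsWithin, Metric.tendsto_nhds.1 hPlim (δ / 3) (by positivity),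
    hlim.eventually_lt_const (lt_of_le_of_lt (le_abs_self c) (lt_add_one |c|))] with ε hε h1 h2
  have hε' : (0 : ℝ) < ε := hε
  have hΛ : |ε * (∫ ω, w ω * Real.exp (-(ε * L ω)) * h (Real.exp (-(ε * L ω))) ∂μ)
      - ε * ∫ ω, w ω * Real.exp (-(ε * L ω)) * P.eval (Real.exp (-(ε * L ω))) ∂μ| ≤ δ / 3 := by
    rw [← mul_sub, ← integral_sub (hinth ε hε) (hPint ε hε), abs_mul, abs_of_pos hε']
    have : ‖∫ ω, (w ω * Real.exp (-(ε * L ω)) * h (Real.exp (-(ε * L ω)))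
        - w ω * Real.exp (-(ε * L ω)) * P.eval (Real.exp (-(ε * L ω)))) ∂μ‖
        ≤ ∫ ω, η * (w ω * Real.exp (-(ε * L ω))) ∂μ := by
      refine norm_integral_le_of_norm_le ((hint ε hε).const_mul η) (ae_of_all _ fun ω => ?_)
      have hnn : 0 ≤ w ω * Real.exp (-(ε * L ω)) := mul_nonneg (hw0 ω) (Real.exp_pos _).le
      rw [← mul_sub, norm_mul, Real.norm_of_nonneg hnn, mul_comm, Real.norm_eq_abs, abs_sub_comm]
      exact mul_le_mul_of_nonneg_right (hP _ (hmem ε hε ω)).le hnn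
    rw [integral_const_mul, Real.norm_eq_abs] at this
    nlinarith [mul_le_mul_of_nonneg_left this hε'.le, mul_lt_mul_of_pos_left h2 hη0]
  rw [Real.dist_eq] at h1 ⊢
  rw [abs_lt] at *
  rw [abs_le] at *
  constructor <;> linarith [h1.1, h1.2, hIdiff.1, hIdiff.2, hΛ.1, hΛ.2]

/-- A continuous test function approximating `x ↦ x⁻¹ 1{x ≥ β}`, supported in `[α, ∞)`. -/
noncomputable def smoothCutoff (α β x : ℝ) : ℝ := max 0 (min 1 ((x - α) / (β - α))) / max x α

lemma continuous_smoothCutoff {α : ℝ} (hα : 0 < α) (β : ℝ) : Continuous (smoothCutoff α β) := by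
  unfold smoothCutoff
  refine Continuous.div (by fun_prop) (by fun_prop) fun x => ?_
  exact (lt_of_lt_of_le hα (le_max_right _ _)).ne'

lemma smoothCutoff_nonneg {α : ℝ} (hα : 0 < α) (β x : ℝ) : 0 ≤ smoothCutoff α β x :=
  div_nonneg (le_max_left _ _) (hα.le.trans (le_max_right _ _))

lemma smoothCutoff_eq_zero {α β x : ℝ} (hαβ : α < β) (hx : x ≤ α) : smoothCutoff α β x = 0 := by
  have : (x - α) / (β - α) ≤ 0 := div_nonpos_of_nonpos_of_nonneg (by linarith) (by linarith)
  rw [smoothCutoff, max_eq_left ((min_le_right _ _).trans this), zero_div]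

lemma smoothCutoff_eq_inv {α β x : ℝ} (hαβ : α < β) (hx : β ≤ x) :
    smoothCutoff α β x = x⁻¹ := by
  have : 1 ≤ (x - α) / (β - α) := (one_le_div (by linarith)).2 (by linarith)
  rw [smoothCutoff, min_eq_left this, max_eq_right zero_le_one, max_eq_left (by linarith),
    one_div]

lemma smoothCutoff_le_inv {α β x : ℝ} (hα : 0 < α) (hx : α ≤ x) :
    smoothCutoff α β x ≤ x⁻¹ := by
  rw [smoothCutoff, max_eq_left hx, inv_eq_one_div]
  exact div_le_div_of_nonneg_right (max_le zero_le_one (min_le_left _ _)) (hα.le.trans hx)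

lemma integral_smoothCutoff_le {α β : ℝ} (hα : 0 < α) (hαβ : α < β) (hα1 : α ≤ 1) :
    ∫ x in (0 : ℝ)..1, smoothCutoff α β x ≤ -Real.log α := by
  have hc := continuous_smoothCutoff hα β
  rw [← intervalIntegral.integral_add_adjacent_intervals (hc.intervalIntegrable 0 α)
    (hc.intervalIntegrable α 1)]
  have h0 : ∫ x in (0 : ℝ)..α, smoothCutoff α β x = 0 := by
    rw [intervalIntegral.integral_congr (g := fun _ => (0 : ℝ)), intervalIntegral.integral_zero]
    intro x hx
    rw [Set.uIcc_of_le hα.le] at hx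
    exact smoothCutoff_eq_zero hαβ hx.2
  have h1 : ∫ x in α..1, smoothCutoff α β x ≤ ∫ x in α..1, x⁻¹ := by
    refine intervalIntegral.integral_mono_on hα1 (hc.intervalIntegrable _ _) ?_
      fun x hx => smoothCutoff_le_inv hα hx.1
    exact intervalIntegrable_inv_iff.2 (Or.inr (by
      rw [Set.uIcc_of_le hα1]; exact fun h => hα.not_ge h.1))
  rw [integral_inv_of_pos hα one_pos, one_div, Real.log_inv] at h1
  linarith

lemma le_integral_smoothCutoff {α β : ℝ} (hα : 0 < α) (hαβ : α < β) (hβ1 : β ≤ 1) :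
    -Real.log β ≤ ∫ x in (0 : ℝ)..1, smoothCutoff α β x := by
  have hc := continuous_smoothCutoff hα β
  have hβ : 0 < β := hα.trans hαβ
  rw [← intervalIntegral.integral_add_adjacent_intervals (hc.intervalIntegrable 0 β)
    (hc.intervalIntegrable β 1)]
  have h0 : 0 ≤ ∫ x in (0 : ℝ)..β, smoothCutoff α β x :=
    intervalIntegral.integral_nonneg hβ.le fun x _ => smoothCutoff_nonneg hα β x
  have h1 : ∫ x in β..1, smoothCutoff α β x = ∫ x in β..1, x⁻¹ := by
    refine intervalIntegral.integral_congr fun x hx => ?_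
    rw [Set.uIcc_of_le hβ1] at hx
    exact smoothCutoff_eq_inv hαβ hx.1
  rw [integral_inv_of_pos hβ one_pos, one_div, Real.log_inv] at h1
  linarith

/-- **Karamata's Tauberian theorem** with index one: if `ε ∫ w e^{-ε L} → c` as `ε → 0+`, then
`s⁻¹ ∫ w 1{L ≤ s} → c` as `s → ∞`. -/
theorem tendsto_truncated_integral_of_tendsto_laplace
    (hw : Measurable w) (hL : Measurable L) (hw0 : ∀ ω, 0 ≤ w ω) (hL0 : ∀ ω, 0 ≤ L ω)
    (hint : ∀ ε > 0, Integrable (fun ω => w ω * Real.exp (-(ε * L ω))) μ)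
    (hlim : Tendsto (fun ε => ε * ∫ ω, w ω * Real.exp (-(ε * L ω)) ∂μ) (𝓝[>] 0) (𝓝 c)) :
    Tendsto (fun s : ℝ => s⁻¹ * ∫ ω, (if L ω ≤ s then w ω else 0) ∂μ) atTop (𝓝 c) := by
  have hc0 : 0 ≤ c := by
    refine ge_of_tendsto hlim ?_
    filter_upwards [self_mem_nhdsWithin] with ε hε
    exact mul_nonneg (le_of_lt hε)
      (integral_nonneg fun ω => mul_nonneg (hw0 ω) (Real.exp_pos _).le)
  have hexp : ∀ s > 0, ∀ ω, L ω ≤ s ↔ Real.exp (-1) ≤ Real.exp (-(s⁻¹ * L ω)) := by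
    intro s hs ω
    rw [Real.exp_le_exp, neg_le_neg_iff, inv_mul_le_iff₀ hs, mul_one]
  have hmul : ∀ α β x y : ℝ, β ≤ x → α < β → 0 < α → y * x * smoothCutoff α β x = y := by
    intro α β x y hx hαβ hα
    have : x ≠ 0 := by linarith
    rw [smoothCutoff_eq_inv hαβ hx]
    field_simp
  have hle : ∀ α β, 0 < α → α < β → ∀ x y : ℝ, 0 ≤ y → 0 < x →
      y * x * smoothCutoff α β x ≤ y := by
    intro α β hα hαβ x y hy hx
    rcases le_total x α with h | h
    · rw [smoothCutoff_eq_zero hαβ h, mul_zero]; exact hy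
    · calc y * x * smoothCutoff α β x ≤ y * x * x⁻¹ :=
          mul_le_mul_of_nonneg_left (smoothCutoff_le_inv hα h) (by positivity)
        _ = y := by field_simp
  have hlimh : ∀ α β : ℝ, 0 < α → _ := fun α β hα =>
    tendsto_laplace_mul_continuous hL hw0 hL0 hint hlim (continuous_smoothCutoff hα β)
  have hinttr : ∀ s > 0, Integrable (fun ω => if L ω ≤ s then w ω else 0) μ := by
    intro s hs
    refine ((hint s⁻¹ (inv_pos.2 hs)).const_mul (Real.exp 1)).mono'
      (Measurable.ite (measurableSet_le hL measurable_const) hw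
        measurable_const).aestronglyMeasurable (ae_of_all _ fun ω => ?_)
    split_ifs with h
    · rw [Real.norm_of_nonneg (hw0 ω)]
      have h1 := (hexp s hs ω).1 h
      have h2 : Real.exp 1 * Real.exp (-1) = 1 := by rw [← Real.exp_add]; simp
      have h3 : 1 ≤ Real.exp 1 * Real.exp (-(s⁻¹ * L ω)) := by
        exact h2.symm.trans_le (mul_le_mul_of_nonneg_left h1 (Real.exp_pos 1).le)
      nlinarith [hw0 ω]
    · rw [norm_zero]
      exact mul_nonneg (Real.exp_pos _).le (mul_nonneg (hw0 ω) (Real.exp_pos _).le)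
  refine tendsto_order.2 ⟨fun a ha => ?_, fun a ha => ?_⟩
  · obtain ⟨η, hη0, hη1, hη⟩ : ∃ η : ℝ, 0 < η ∧ η < 1 ∧ a < c * (1 - η) := by
      have ht : Tendsto (fun η : ℝ => c * (1 - η)) (𝓝[>] 0) (𝓝 (c * (1 - 0))) :=
        ((continuous_const.mul (continuous_const.sub continuous_id)).tendsto 0).mono_left
          nhdsWithin_le_nhds
      rw [sub_zero, mul_one] at ht
      obtain ⟨η, h1, h2, h3⟩ := ((ht.eventually_const_lt ha).and
        (Ioo_mem_nhdsGT (zero_lt_one (α := ℝ)))).exists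
      exact ⟨η, h2, h3, h1⟩
    have hαβ : Real.exp (-1) < Real.exp (-(1 - η)) := Real.exp_lt_exp.2 (by linarith)
    have hI := le_integral_smoothCutoff (Real.exp_pos (-1)) hαβ
      (Real.exp_le_one_iff.2 (by linarith))
    rw [Real.log_exp, neg_neg] at hI
    have hlim' := (hlimh _ (Real.exp (-(1 - η))) (Real.exp_pos (-1))).2.comp
      tendsto_inv_atTop_nhdsGT_zero
    filter_upwards [hlim'.eventually_const_lt
      (hη.trans_le (mul_le_mul_of_nonneg_left hI hc0)), eventually_gt_atTop 0] with s h1 hs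
    refine h1.trans_le (mul_le_mul_of_nonneg_left ?_ (inv_pos.2 hs).le)
    refine integral_mono ((hlimh _ _ (Real.exp_pos (-1))).1 _ (inv_pos.2 hs)) (hinttr s hs)
      fun ω => ?_
    dsimp only
    split_ifs with h
    · exact hle _ _ (Real.exp_pos _) hαβ _ _ (hw0 ω) (Real.exp_pos _)
    · rw [hexp s hs, not_le] at h
      rw [smoothCutoff_eq_zero hαβ h.le, mul_zero]
  · obtain ⟨η, hη0, hη⟩ : ∃ η : ℝ, 0 < η ∧ c * (1 + η) < a := by
      have ht : Tendsto (fun η : ℝ => c * (1 + η)) (𝓝[>] 0) (𝓝 (c * (1 + 0))) :=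
        ((continuous_const.mul (continuous_const.add continuous_id)).tendsto 0).mono_left
          nhdsWithin_le_nhds
      rw [add_zero, mul_one] at ht
      obtain ⟨η, h1, h2⟩ := ((ht.eventually_lt_const ha).and self_mem_nhdsWithin).exists
      exact ⟨η, h2, h1⟩
    have hαβ : Real.exp (-(1 + η)) < Real.exp (-1) := Real.exp_lt_exp.2 (by linarith)
    have hI := integral_smoothCutoff_le (Real.exp_pos (-(1 + η))) hαβ
      (Real.exp_le_one_iff.2 (by linarith))
    rw [Real.log_exp, neg_neg] at hI
    have hlim' := (hlimh _ (Real.exp (-1)) (Real.exp_pos (-(1 + η)))).2.comp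
      tendsto_inv_atTop_nhdsGT_zero
    filter_upwards [hlim'.eventually_lt_const
      ((mul_le_mul_of_nonneg_left hI hc0).trans_lt hη), eventually_gt_atTop 0] with s h1 hs
    refine lt_of_le_of_lt (mul_le_mul_of_nonneg_left ?_ (inv_pos.2 hs).le) h1
    refine integral_mono (hinttr s hs) ((hlimh _ _ (Real.exp_pos _)).1 _ (inv_pos.2 hs))
      fun ω => ?_
    dsimp only
    split_ifs with h
    · exact (hmul _ _ _ _ ((hexp s hs ω).1 h) hαβ (Real.exp_pos _)).ge
    · exact mul_nonneg (mul_nonneg (hw0 ω) (Real.exp_pos _).le)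
        (smoothCutoff_nonneg (Real.exp_pos _) _ _)

end Tauberian

section Moments

open scoped ENNReal

variable {Ω : Type*} [MeasurableSpace Ω] {μ : Measure Ω}

lemma lintegral_min_le (f g : Ω → ℝ≥0∞) :
    ∫⁻ ω, min (f ω) (g ω) ∂μ ≤ min (∫⁻ ω, f ω ∂μ) (∫⁻ ω, g ω ∂μ) :=
  le_min (lintegral_mono fun _ => min_le_left _ _) (lintegral_mono fun _ => min_le_right _ _)

variable [IsProbabilityMeasure μ]

lemma lintegral_comp_prod_of_indepFun {X Y : Type*} [MeasurableSpace X] [MeasurableSpace Y]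
    {u : Ω → X} {v : Ω → Y} (hu : Measurable u) (hv : Measurable v) (hind : IndepFun u v μ)
    {F : X × Y → ℝ≥0∞} (hF : Measurable F) :
    ∫⁻ ω, F (u ω, v ω) ∂μ = ∫⁻ ω, ∫⁻ ω', F (u ω, v ω') ∂μ ∂μ := by
  rw [← lintegral_map hF (hu.prodMk hv),
    (indepFun_iff_map_prod_eq_prod_map_map hu.aemeasurable hv.aemeasurable).1 hind,
    lintegral_prod _ hF.aemeasurable, lintegral_map hF.lintegral_prod_right' hu]
  exact lintegral_congr fun ω => lintegral_map (hF.comp measurable_prodMk_left) hv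

variable {u a b : Ω → ℝ≥0∞}

/-- A small moment of a solution of `u =_d a u + b` is finite. -/
lemma lintegral_rpow_ne_top_of_le_one (hu : Measurable u) (ha : Measurable a) (hb : Measurable b)
    (hind : IndepFun u a μ) (hfix : μ.map u = μ.map (fun ω => a ω * u ω + b ω))
    (hfin : ∀ ω, u ω ≠ ∞) {q : ℝ} (hq0 : 0 < q) (hq1 : q ≤ 1)
    (haq : ∫⁻ ω, a ω ^ q ∂μ < 1) (hbq : ∫⁻ ω, b ω ^ q ∂μ ≠ ∞) :
    ∫⁻ ω, u ω ^ q ∂μ ≠ ∞ := by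
  set r := ∫⁻ ω, a ω ^ q ∂μ with hr
  set β := ∫⁻ ω, b ω ^ q ∂μ with hβ
  have hstep : ∀ M : ℕ, ∀ n : ℕ, ∫⁻ ω, min (r ^ n * u ω ^ q) M ∂μ
      ≤ ∫⁻ ω, min (r ^ (n + 1) * u ω ^ q) M ∂μ + r ^ n * β := by
    intro M n
    have hmeas : Measurable fun x : ℝ≥0∞ => min (r ^ n * x ^ q) (M : ℝ≥0∞) := by fun_prop
    calc ∫⁻ ω, min (r ^ n * u ω ^ q) M ∂μ
        = ∫⁻ ω, min (r ^ n * (a ω * u ω + b ω) ^ q) M ∂μ := by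
          rw [← lintegral_map (f := fun x : ℝ≥0∞ => min (r ^ n * x ^ q) (M : ℝ≥0∞)) hmeas hu,
            hfix, lintegral_map hmeas (by fun_prop)]
      _ ≤ ∫⁻ ω, (min (r ^ n * (a ω * u ω) ^ q) M + r ^ n * b ω ^ q) ∂μ := by
          refine lintegral_mono fun ω => ?_
          have h1 : r ^ n * (a ω * u ω + b ω) ^ q
              ≤ r ^ n * (a ω * u ω) ^ q + r ^ n * b ω ^ q := by
            rw [← mul_add]
            gcongr
            exact ENNReal.rpow_add_le_add_rpow _ _ hq0.le hq1
          rw [min_add]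
          exact le_min ((min_le_left _ _).trans h1) ((min_le_right _ _).trans le_self_add)
      _ = ∫⁻ ω, min (r ^ n * (a ω * u ω) ^ q) M ∂μ + r ^ n * β := by
          rw [lintegral_add_right _ (by fun_prop), lintegral_const_mul _ (by fun_prop)]
      _ ≤ _ := by
          refine add_le_add_left ?_ _
          rw [lintegral_comp_prod_of_indepFun hu ha hind
            (F := fun p => min (r ^ n * (p.2 * p.1) ^ q) (M : ℝ≥0∞)) (by fun_prop)]
          refine lintegral_mono fun ω => (lintegral_min_le _ _).trans ?_
          refine min_le_min (le_of_eq ?_) (by simp)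
          simp only [ENNReal.mul_rpow_of_nonneg _ _ hq0.le]
          rw [lintegral_const_mul _ (by fun_prop), lintegral_mul_const _ (by fun_prop), pow_succ,
            mul_assoc]
  have hsum : ∀ M n : ℕ, ∫⁻ ω, min (u ω ^ q) M ∂μ
      ≤ ∫⁻ ω, min (r ^ n * u ω ^ q) M ∂μ + (∑ k ∈ Finset.range n, r ^ k) * β := by
    intro M n
    induction n with
    | zero => simp
    | succ n ih =>
      refine ih.trans ((add_le_add_left (hstep M n) _).trans (le_of_eq ?_))
      rw [Finset.sum_range_succ]
      ring
  have hlim : ∀ M : ℕ, Tendsto (fun n : ℕ => ∫⁻ ω, min (r ^ n * u ω ^ q) M ∂μ) atTop (𝓝 0) := by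
    intro M
    have := tendsto_lintegral_of_dominated_convergence (μ := μ)
      (F := fun n : ℕ => fun ω => min (r ^ n * u ω ^ q) (M : ℝ≥0∞)) (f := fun _ => 0)
      (fun _ => (M : ℝ≥0∞)) (fun n => by fun_prop)
      (fun n => ae_of_all _ fun ω => min_le_right _ _) (by simp)
      (ae_of_all _ fun ω => by
        have h1 : Tendsto (fun n : ℕ => r ^ n * u ω ^ q) atTop (𝓝 (0 * u ω ^ q)) :=
          ENNReal.Tendsto.mul_const (ENNReal.tendsto_pow_atTop_nhds_zero_of_lt_one haq)
            (Or.inr (ENNReal.rpow_ne_top_of_nonneg hq0.le (hfin ω)))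
        rw [zero_mul] at h1
        exact tendsto_of_tendsto_of_tendsto_of_le_of_le tendsto_const_nhds h1
          (fun _ => zero_le) (fun _ => min_le_left _ _))
    simpa using this
  have hbound : ∀ M : ℕ, ∫⁻ ω, min (u ω ^ q) M ∂μ ≤ (1 - r)⁻¹ * β := by
    intro M
    have ht := (hlim M).add_const ((1 - r)⁻¹ * β)
    rw [zero_add] at ht
    refine ge_of_tendsto' ht fun n => (hsum M n).trans ?_
    gcongr
    rw [← ENNReal.tsum_geometric]
    exact ENNReal.sum_le_tsum _
  have hmono : Tendsto (fun M : ℕ => ∫⁻ ω, min (u ω ^ q) M ∂μ) atTop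
      (𝓝 (∫⁻ ω, u ω ^ q ∂μ)) := by
    refine lintegral_tendsto_of_tendsto_of_monotone (fun M => by fun_prop)
      (ae_of_all _ fun ω M N h => min_le_min le_rfl (by exact_mod_cast h))
      (ae_of_all _ fun ω => ?_)
    obtain ⟨N, hN⟩ := ENNReal.exists_nat_gt (ENNReal.rpow_ne_top_of_nonneg hq0.le (hfin ω))
    refine tendsto_atTop_of_eventually_const (i₀ := N) fun M hM => min_eq_left ?_
    exact hN.le.trans (by exact_mod_cast hM)
  refine ne_top_of_le_ne_top ?_ (le_of_tendsto' hmono hbound)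
  exact ENNReal.mul_ne_top (ENNReal.inv_ne_top.2 (tsub_pos_of_lt haq).ne') hbq

lemma ENNReal.le_inv_mul_of_le_mul_add {x θ K : ℝ≥0∞} (hx : x ≠ ∞) (hθ : θ < 1)
    (h : x ≤ θ * x + K) : x ≤ (1 - θ)⁻¹ * K := by
  have h0 : 1 - θ ≠ 0 := (tsub_pos_of_lt hθ).ne'
  have h1 : 1 - θ ≠ ∞ := ENNReal.sub_ne_top ENNReal.one_ne_top
  rw [← ENNReal.div_eq_inv_mul, ENNReal.le_div_iff_mul_le (Or.inl h0) (Or.inl h1), mul_comm,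
    ENNReal.sub_mul (fun _ _ => hx), one_mul]
  exact tsub_le_iff_left.2 h

lemma min_rpow_add_le {p q : ℝ} (hq : 0 < q) (hqp : q ≤ p) (M : ℝ≥0∞) {δ : ℝ≥0∞} (hδ : δ ≠ 0)
    (hδt : δ ≠ ∞) (x y : ℝ≥0∞) :
    min ((x + y) ^ p) (M * (x + y) ^ q)
      ≤ (1 + δ) ^ p * min (x ^ p) (M * x ^ q) + (1 + δ⁻¹) ^ p * y ^ p := by
  have hp : 0 < p := hq.trans_le hqp
  rcases le_total y (δ * x) with h | h
  · refine le_trans ?_ le_self_add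
    have hxy : x + y ≤ (1 + δ) * x := by rw [add_mul, one_mul]; gcongr
    rw [mul_min]
    refine min_le_min ?_ ?_
    · rw [← ENNReal.mul_rpow_of_nonneg _ _ hp.le]
      gcongr
    · calc M * (x + y) ^ q ≤ M * ((1 + δ) * x) ^ q := by gcongr
        _ = (1 + δ) ^ q * (M * x ^ q) := by rw [ENNReal.mul_rpow_of_nonneg _ _ hq.le]; ring
        _ ≤ (1 + δ) ^ p * (M * x ^ q) := by
          gcongr
          exact le_self_add
  · refine le_trans (min_le_left _ _) (le_trans ?_ le_add_self)
    rw [← ENNReal.mul_rpow_of_nonneg _ _ hp.le]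
    gcongr
    rw [add_mul, one_mul, add_comm]
    gcongr
    rwa [← ENNReal.div_eq_inv_mul, ENNReal.le_div_iff_mul_le (Or.inl hδ) (Or.inl hδt), mul_comm]

/-- Bootstrapping from a small moment to a larger one. -/
lemma lintegral_rpow_ne_top_of_lintegral_rpow_ne_top
    (hu : Measurable u) (ha : Measurable a) (hb : Measurable b)
    (hind : IndepFun u a μ) (hfix : μ.map u = μ.map (fun ω => a ω * u ω + b ω))
    (hfin : ∀ ω, u ω ≠ ∞) {p q : ℝ} (hq : 0 < q) (hqp : q ≤ p)
    (haq : ∫⁻ ω, a ω ^ q ∂μ < 1) (hap : ∫⁻ ω, a ω ^ p ∂μ < 1)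
    (hbp : ∫⁻ ω, b ω ^ p ∂μ ≠ ∞) (huq : ∫⁻ ω, u ω ^ q ∂μ ≠ ∞) :
    ∫⁻ ω, u ω ^ p ∂μ ≠ ∞ := by
  have hp : 0 < p := hq.trans_le hqp
  set ρ := max (∫⁻ ω, a ω ^ q ∂μ) (∫⁻ ω, a ω ^ p ∂μ) with hρ
  have hρ1 : ρ < 1 := max_lt haq hap
  obtain ⟨δ, hδ0, hδt, hδ⟩ : ∃ δ : ℝ≥0∞, δ ≠ 0 ∧ δ ≠ ∞ ∧ (1 + δ) ^ p * ρ < 1 := by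
    have h1 : Tendsto (fun δ : ℝ≥0∞ => (1 + δ) ^ p * ρ) (𝓝[>] 0) (𝓝 ((1 + 0) ^ p * ρ)) := by
      refine Tendsto.mono_left ?_ nhdsWithin_le_nhds
      refine ENNReal.Tendsto.mul_const ?_ (Or.inr hρ1.ne_top)
      exact (ENNReal.continuous_rpow_const.comp (continuous_const.add continuous_id)).tendsto 0
    rw [add_zero, ENNReal.one_rpow, one_mul] at h1
    obtain ⟨δ, h2, h3, h4⟩ := ((h1.eventually_lt_const hρ1).and
      (Ioo_mem_nhdsGT (zero_lt_one (α := ℝ≥0∞)))).exists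
    exact ⟨δ, h3.ne', h4.ne_top, h2⟩
  set θ := (1 + δ) ^ p * ρ with hθ
  set K := (1 + δ⁻¹) ^ p * ∫⁻ ω, b ω ^ p ∂μ with hK
  have hKt : K ≠ ∞ := by
    refine ENNReal.mul_ne_top (ENNReal.rpow_ne_top_of_nonneg hp.le ?_) hbp
    simp [hδ0]
  have hstep : ∀ M : ℕ, ∫⁻ ω, min (u ω ^ p) (M * u ω ^ q) ∂μ
      ≤ θ * ∫⁻ ω, min (u ω ^ p) (M * u ω ^ q) ∂μ + K := by
    intro M
    have hmeas : Measurable fun x : ℝ≥0∞ => min (x ^ p) (M * x ^ q) := by fun_prop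
    calc ∫⁻ ω, min (u ω ^ p) (M * u ω ^ q) ∂μ
        = ∫⁻ ω, min ((a ω * u ω + b ω) ^ p) (M * (a ω * u ω + b ω) ^ q) ∂μ := by
          rw [← lintegral_map (f := fun x : ℝ≥0∞ => min (x ^ p) (M * x ^ q)) hmeas hu,
            hfix, lintegral_map hmeas (by fun_prop)]
      _ ≤ ∫⁻ ω, ((1 + δ) ^ p * min ((a ω * u ω) ^ p) (M * (a ω * u ω) ^ q)
            + (1 + δ⁻¹) ^ p * b ω ^ p) ∂μ :=
          lintegral_mono fun ω => min_rpow_add_le hq hqp _ hδ0 hδt _ _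
      _ = (1 + δ) ^ p * ∫⁻ ω, min ((a ω * u ω) ^ p) (M * (a ω * u ω) ^ q) ∂μ + K := by
          rw [lintegral_add_right _ (by fun_prop), lintegral_const_mul _ (by fun_prop),
            lintegral_const_mul _ (by fun_prop)]
      _ ≤ _ := by
          rw [hθ, mul_assoc]
          gcongr
          rw [lintegral_comp_prod_of_indepFun hu ha hind
            (F := fun x => min ((x.2 * x.1) ^ p) (M * (x.2 * x.1) ^ q)) (by fun_prop),
            ← lintegral_const_mul _ (by fun_prop)]
          refine lintegral_mono fun ω => (lintegral_min_le _ _).trans ?_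
          simp only [ENNReal.mul_rpow_of_nonneg _ _ hq.le, ENNReal.mul_rpow_of_nonneg _ _ hp.le]
          rw [lintegral_const_mul _ (by fun_prop), lintegral_mul_const _ (by fun_prop),
            lintegral_mul_const _ (by fun_prop), mul_min, mul_left_comm ρ]
          gcongr
          · exact le_max_right _ _
          · exact le_max_left _ _
  have hbound : ∀ M : ℕ, ∫⁻ ω, min (u ω ^ p) (M * u ω ^ q) ∂μ ≤ (1 - θ)⁻¹ * K := by
    intro M
    refine ENNReal.le_inv_mul_of_le_mul_add ?_ hδ (hstep M)
    refine ne_top_of_le_ne_top ?_ (lintegral_mono fun ω => min_le_right _ _)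
    rw [lintegral_const_mul _ (by fun_prop)]
    exact ENNReal.mul_ne_top (ENNReal.natCast_ne_top M) huq
  have hmono : Tendsto (fun M : ℕ => ∫⁻ ω, min (u ω ^ p) (M * u ω ^ q) ∂μ) atTop
      (𝓝 (∫⁻ ω, u ω ^ p ∂μ)) := by
    refine lintegral_tendsto_of_tendsto_of_monotone (fun M => by fun_prop)
      (ae_of_all _ fun ω M N h => min_le_min le_rfl (by gcongr))
      (ae_of_all _ fun ω => ?_)
    rcases eq_or_ne (u ω) 0 with h0 | h0
    · simp [h0, hp, hq]
    obtain ⟨N, hN⟩ := ENNReal.exists_nat_gt (ENNReal.rpow_ne_top_of_nonneg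
      (sub_nonneg.2 hqp) (hfin ω))
    refine tendsto_atTop_of_eventually_const (i₀ := N) fun M hM => min_eq_left ?_
    calc u ω ^ p = u ω ^ (p - q) * u ω ^ q := by
          rw [← ENNReal.rpow_add _ _ h0 (hfin ω), sub_add_cancel]
      _ ≤ M * u ω ^ q := by
          gcongr
          exact hN.le.trans (by exact_mod_cast hM)
  refine ne_top_of_le_ne_top ?_ (le_of_tendsto' hmono hbound)
  exact ENNReal.mul_ne_top (ENNReal.inv_ne_top.2 (tsub_pos_of_lt hδ).ne') hKt

end Moments

section Multiplier

variable {Ω : Type*} [MeasurableSpace Ω] {μ : Measure Ω} {A : Ω → ℝ} {κ : ℝ}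

lemma rpow_le_one_add_rpow {x p q : ℝ} (hx : 0 ≤ x) (hp : 0 ≤ p) (hpq : p ≤ q) :
    x ^ p ≤ 1 + x ^ q := by
  rcases le_total x 1 with h | h
  · exact (Real.rpow_le_one hx h hp).trans (le_add_of_nonneg_right (Real.rpow_nonneg hx _))
  · exact (Real.rpow_le_rpow_of_exponent_le h hpq).trans (le_add_of_nonneg_left zero_le_one)

lemma integrable_rpow_of_le [IsFiniteMeasure μ] (hA : Measurable A) (hA0 : ∀ ω, 0 ≤ A ω)
    {p q : ℝ} (hp : 0 ≤ p) (hpq : p ≤ q) (hint : Integrable (fun ω => A ω ^ q) μ) :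
    Integrable (fun ω => A ω ^ p) μ := by
  refine ((integrable_const 1).add hint).mono' (hA.pow_const p).aestronglyMeasurable
    (ae_of_all _ fun ω => ?_)
  rw [Real.norm_of_nonneg (Real.rpow_nonneg (hA0 ω) _)]
  exact rpow_le_one_add_rpow (hA0 ω) hp hpq

lemma rpow_lt_one_add_mul_rpow_sub_one {a q : ℝ} (ha : 0 ≤ a) (ha1 : a ≠ 1) (hq : 0 < q)
    (hqκ : q < κ) : a ^ q < 1 + q / κ * (a ^ κ - 1) := by
  have hκ : 0 < κ := hq.trans hqκ
  have h1 : a ^ κ - 1 ≠ 0 := by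
    rw [sub_ne_zero, Ne, ← Real.one_rpow κ, Real.rpow_left_inj ha zero_le_one hκ.ne']
    exact ha1
  have h2 := rpow_one_add_lt_one_add_mul_self (s := a ^ κ - 1) (p := q / κ)
    (by linarith [Real.rpow_nonneg ha κ]) h1 (div_pos hq hκ) ((div_lt_one hκ).2 hqκ)
  rwa [add_sub_cancel, ← Real.rpow_mul ha, mul_div_cancel₀ _ hκ.ne'] at h2

lemma integral_rpow_lt_one [IsProbabilityMeasure μ] (hA : Measurable A) (hA0 : ∀ ω, 0 ≤ A ω)
    (hAne1 : μ {ω | A ω = 1} < 1) (hAint : Integrable (fun ω => A ω ^ κ) μ)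
    (hAκ : ∫ ω, A ω ^ κ ∂μ = 1) {q : ℝ} (hq : 0 < q) (hqκ : q < κ) :
    ∫ ω, A ω ^ q ∂μ < 1 := by
  have hintq := integrable_rpow_of_le hA hA0 hq.le hqκ.le hAint
  have hints : Integrable (fun ω => q / κ * (A ω ^ κ - 1)) μ :=
    (hAint.sub (integrable_const 1)).const_mul _
  have hintg : Integrable (fun ω => 1 + q / κ * (A ω ^ κ - 1)) μ := (integrable_const 1).add hints
  have hg : ∫ ω, (1 + q / κ * (A ω ^ κ - 1)) ∂μ = 1 := by
    rw [integral_add (integrable_const 1) hints,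
      integral_const_mul, integral_sub hAint (integrable_const 1), hAκ]
    simp
  have hlt : ∀ ω, A ω ≠ 1 → A ω ^ q < 1 + q / κ * (A ω ^ κ - 1) := fun ω h =>
    rpow_lt_one_add_mul_rpow_sub_one (hA0 ω) h hq hqκ
  have hpos : 0 < ∫ ω, ((1 + q / κ * (A ω ^ κ - 1)) - A ω ^ q) ∂μ := by
    refine (integral_pos_iff_support_of_nonneg (fun ω => ?_) (hintg.sub hintq)).2 ?_
    · rcases eq_or_ne (A ω) 1 with h | h
      · simp [h]
      · exact sub_nonneg.2 (hlt ω h).le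
    · have hsub : {ω | A ω = 1}ᶜ ⊆
          Function.support fun ω => (1 + q / κ * (A ω ^ κ - 1)) - A ω ^ q :=
        fun ω h => (sub_pos.2 (hlt ω h)).ne'
      refine lt_of_lt_of_le ?_ (measure_mono hsub)
      rw [prob_compl_eq_one_sub (measurableSet_eq_fun hA measurable_const)]
      exact tsub_pos_of_lt hAne1
  rw [integral_sub hintg hintq, hg] at hpos
  linarith

lemma rpow_sub_rpow_le {a ε : ℝ} (ha : 0 ≤ a) (hε : 0 < ε) (hεκ : ε < κ) :
    (a ^ κ - a ^ (κ - ε)) / ε ≤ a ^ κ * Real.log a := by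
  rcases ha.eq_or_lt with rfl | ha
  · rw [Real.zero_rpow (by linarith), Real.zero_rpow (by linarith)]
    simp
  · have h1 : a ^ (κ - ε) = a ^ κ * Real.exp (-(ε * Real.log a)) := by
      rw [sub_eq_add_neg, Real.rpow_add ha, Real.rpow_def_of_pos ha (-ε)]
      ring_nf
    rw [div_le_iff₀ hε, h1]
    nlinarith [Real.add_one_le_exp (-(ε * Real.log a)), Real.rpow_pos_of_pos ha κ]

lemma le_rpow_sub_rpow {a ε : ℝ} (ha : 0 ≤ a) (hε : 0 < ε) (hεκ : ε < κ) :
    a ^ (κ - ε) * Real.log a ≤ (a ^ κ - a ^ (κ - ε)) / ε := by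
  rcases ha.eq_or_lt with rfl | ha
  · rw [Real.zero_rpow (by linarith), Real.zero_rpow (by linarith)]
    simp
  · have h1 : a ^ κ = a ^ (κ - ε) * Real.exp (ε * Real.log a) := by
      conv_lhs => rw [← sub_add_cancel κ ε, Real.rpow_add ha, Real.rpow_def_of_pos ha ε]
      ring_nf
    rw [le_div_iff₀ hε, h1]
    nlinarith [Real.add_one_le_exp (ε * Real.log a), Real.rpow_pos_of_pos ha (κ - ε)]

lemma neg_inv_le_rpow_mul_log {a p : ℝ} (ha : 0 ≤ a) (hp : 0 < p) :
    -p⁻¹ ≤ a ^ p * Real.log a := by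
  rcases ha.eq_or_lt with rfl | ha
  · simp [hp.le]
  · have hy := Real.rpow_pos_of_pos ha p
    have h1 := Real.one_sub_inv_le_log_of_pos hy
    rw [Real.log_rpow ha] at h1
    have h2 : a ^ p * (1 - (a ^ p)⁻¹) = a ^ p - 1 := by field_simp
    have h3 : -1 ≤ p * (a ^ p * Real.log a) := by
      nlinarith [mul_le_mul_of_nonneg_left h1 hy.le]
    rw [neg_le_iff_add_nonneg, ← mul_nonneg_iff_of_pos_left hp, mul_add, mul_inv_cancel₀ hp.ne']
    linarith

lemma rpow_mul_log_le {a : ℝ} (ha : 0 ≤ a) : a ^ κ * Real.log a ≤ a ^ κ * max (Real.log a) 0 :=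
  mul_le_mul_of_nonneg_left (le_max_left _ _) (Real.rpow_nonneg ha κ)

lemma integrable_rpow_mul_log [IsFiniteMeasure μ] (hA : Measurable A) (hA0 : ∀ ω, 0 ≤ A ω)
    (hκ : 0 < κ) (hlogplus : Integrable (fun ω => A ω ^ κ * max (Real.log (A ω)) 0) μ) :
    Integrable (fun ω => A ω ^ κ * Real.log (A ω)) μ := by
  refine (hlogplus.add (integrable_const κ⁻¹)).mono'
    ((hA.pow_const κ).mul hA.log).aestronglyMeasurable (ae_of_all _ fun ω => ?_)
  have h0 : 0 ≤ A ω ^ κ * max (Real.log (A ω)) 0 :=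
    mul_nonneg (Real.rpow_nonneg (hA0 ω) κ) (le_max_right _ _)
  have h1 := rpow_mul_log_le (κ := κ) (hA0 ω)
  have h2 := neg_inv_le_rpow_mul_log (hA0 ω) hκ
  have h3 := inv_pos.2 hκ
  simp only [Pi.add_apply]
  rw [Real.norm_eq_abs, abs_le]
  constructor <;> linarith

lemma tendsto_one_sub_integral_rpow_div [IsProbabilityMeasure μ] (hA : Measurable A)
    (hA0 : ∀ ω, 0 ≤ A ω) (hκ : 0 < κ) (hAint : Integrable (fun ω => A ω ^ κ) μ)
    (hAκ : ∫ ω, A ω ^ κ ∂μ = 1)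
    (hlogplus : Integrable (fun ω => A ω ^ κ * max (Real.log (A ω)) 0) μ) :
    Tendsto (fun ε => (1 - ∫ ω, A ω ^ (κ - ε) ∂μ) / ε) (𝓝[>] 0)
      (𝓝 (∫ ω, A ω ^ κ * Real.log (A ω) ∂μ)) := by
  have hev : ∀ᶠ ε : ℝ in 𝓝[>] 0, 0 < ε ∧ ε < κ / 2 := Ioo_mem_nhdsGT (by positivity)
  have h : Tendsto (fun ε => ∫ ω, (A ω ^ κ - A ω ^ (κ - ε)) / ε ∂μ) (𝓝[>] 0)
      (𝓝 (∫ ω, A ω ^ κ * Real.log (A ω) ∂μ)) := by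
    refine tendsto_integral_filter_of_dominated_convergence
      (fun ω => A ω ^ κ * max (Real.log (A ω)) 0 + (κ / 2)⁻¹) ?_ ?_
      (hlogplus.add (integrable_const _)) (ae_of_all _ fun ω => ?_)
    · exact Eventually.of_forall fun ε =>
        (((hA.pow_const κ).sub (hA.pow_const (κ - ε))).div_const ε).aestronglyMeasurable
    · filter_upwards [hev] with ε hε
      refine ae_of_all _ fun ω => ?_
      have h0 : 0 ≤ A ω ^ κ * max (Real.log (A ω)) 0 :=
        mul_nonneg (Real.rpow_nonneg (hA0 ω) κ) (le_max_right _ _)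
      have h1 := rpow_sub_rpow_le (κ := κ) (hA0 ω) hε.1 (by linarith)
      have h2 := le_rpow_sub_rpow (κ := κ) (hA0 ω) hε.1 (by linarith)
      have h3 := neg_inv_le_rpow_mul_log (p := κ - ε) (hA0 ω) (by linarith)
      have h4 := rpow_mul_log_le (κ := κ) (hA0 ω)
      have h5 : (κ - ε)⁻¹ ≤ (κ / 2)⁻¹ := inv_anti₀ (by positivity) (by linarith)
      have h6 : 0 < (κ / 2)⁻¹ := by positivity
      rw [Real.norm_eq_abs, abs_le]
      constructor <;> linarith
    · rcases (hA0 ω).eq_or_lt with h0 | h0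
      · refine tendsto_const_nhds.congr' ?_
        filter_upwards [hev] with ε hε
        rw [← h0, Real.zero_rpow hκ.ne', Real.zero_rpow (by linarith : κ - ε ≠ 0)]
        simp
      · have hd := hasDerivAt_iff_tendsto_slope.1
          (Real.hasStrictDerivAt_const_rpow h0 κ).hasDerivAt
        have hsub : Tendsto (fun ε : ℝ => κ - ε) (𝓝[>] 0) (𝓝[≠] κ) := by
          refine tendsto_nhdsWithin_iff.2 ⟨?_, ?_⟩
          · have : Tendsto (fun ε : ℝ => κ - ε) (𝓝 0) (𝓝 (κ - 0)) :=
              (continuous_const.sub continuous_id).tendsto 0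
            rw [sub_zero] at this
            exact this.mono_left nhdsWithin_le_nhds
          · filter_upwards [self_mem_nhdsWithin] with ε (hε : 0 < ε)
            simp [hε.ne']
        refine (hd.comp hsub).congr fun ε => ?_
        simp only [Function.comp_apply, slope_def_field]
        rw [sub_sub_cancel_left, div_neg, ← neg_div, neg_sub]
  refine h.congr' ?_
  filter_upwards [hev] with ε hε
  rw [integral_div, integral_sub hAint
    (integrable_rpow_of_le hA hA0 (by linarith) (by linarith) hAint), hAκ]

lemma integral_rpow_mul_log_pos [IsProbabilityMeasure μ] (hA : Measurable A)
    (hA0 : ∀ ω, 0 ≤ A ω) (hκ : 0 < κ) (hAne1 : μ {ω | A ω = 1} < 1)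
    (hAint : Integrable (fun ω => A ω ^ κ) μ) (hAκ : ∫ ω, A ω ^ κ ∂μ = 1)
    (hlogplus : Integrable (fun ω => A ω ^ κ * max (Real.log (A ω)) 0) μ) :
    0 < ∫ ω, A ω ^ κ * Real.log (A ω) ∂μ := by
  have hε : 0 < κ / 2 := by positivity
  have hint2 := integrable_rpow_of_le hA hA0 (p := κ - κ / 2) (by linarith) (by linarith) hAint
  have h1 : ∫ ω, (A ω ^ κ - A ω ^ (κ - κ / 2)) / (κ / 2) ∂μ
      ≤ ∫ ω, A ω ^ κ * Real.log (A ω) ∂μ :=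
    integral_mono ((hAint.sub hint2).div_const _) (integrable_rpow_mul_log hA hA0 hκ hlogplus)
      fun ω => rpow_sub_rpow_le (hA0 ω) hε (by linarith)
  have h2 := integral_rpow_lt_one hA hA0 hAne1 hAint hAκ (q := κ - κ / 2) (by linarith)
    (by linarith)
  rw [integral_div, integral_sub hAint hint2, hAκ] at h1
  exact (div_pos (by linarith) hε).trans_le h1

end Multiplier

section Increment

variable {Ω : Type*} [MeasurableSpace Ω] {μ : Measure Ω} {A B U : Ω → ℝ} {κ : ℝ}

lemma add_rpow_sub_rpow_le_of_le_one {x b p : ℝ} (hx : 0 ≤ x) (hb : 0 ≤ b) (hp : 0 ≤ p)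
    (hp1 : p ≤ 1) (hpκ : p ≤ κ) : (x + b) ^ p - x ^ p ≤ 1 + b ^ κ := by
  linarith [Real.rpow_add_le_add_rpow hx hb hp hp1, rpow_le_one_add_rpow hb hp hpκ]

lemma add_rpow_sub_rpow_le_mul {x b p : ℝ} (hx : 0 ≤ x) (hb : 0 ≤ b) (hp1 : 1 ≤ p) :
    (x + b) ^ p - x ^ p ≤ p * b * (x + b) ^ (p - 1) := by
  rcases (add_nonneg hx hb).eq_or_lt with h | h
  · have hx0 : x = 0 := by linarith
    have hb0 : b = 0 := by linarith
    simp [hx0, hb0]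
  · have h1 := one_add_mul_self_le_rpow_one_add (s := -(b / (x + b))) (p := p)
      (neg_le_neg ((div_le_one h).2 (by linarith))) hp1
    have h2 : 1 + -(b / (x + b)) = x / (x + b) := by field_simp; ring
    rw [h2, Real.div_rpow hx h.le] at h1
    have hs := Real.rpow_pos_of_pos h p
    rw [le_div_iff₀ hs] at h1
    rw [Real.rpow_sub_one h.ne']
    have h3 : (1 + p * -(b / (x + b))) * (x + b) ^ p
        = (x + b) ^ p - p * b * ((x + b) ^ p / (x + b)) := by
      field_simp
      ring
    linarith

lemma mul_rpow_sub_one_self {x : ℝ} (hx : 0 ≤ x) (hκ : κ ≠ 0) : x * x ^ (κ - 1) = x ^ κ := by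
  rcases hx.eq_or_lt with rfl | h
  · rw [zero_mul, Real.zero_rpow hκ]
  · rw [Real.rpow_sub_one h.ne']
    field_simp

lemma add_rpow_sub_rpow_le_of_one_le {x b p : ℝ} (hx : 0 ≤ x) (hb : 0 ≤ b) (hp1 : 1 ≤ p)
    (hpκ : p ≤ κ) :
    (x + b) ^ p - x ^ p ≤ κ * 2 ^ κ * (b + b * x ^ (κ - 1) + b ^ κ) := by
  have h2κ : (0 : ℝ) ≤ 2 ^ κ := by positivity
  have hxκ := Real.rpow_nonneg hx (κ - 1)
  have hbκ := Real.rpow_nonneg hb κ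
  have hbb : b * b ^ (κ - 1) = b ^ κ := mul_rpow_sub_one_self hb (by linarith)
  have hpow : (x + b) ^ (p - 1) ≤ 2 ^ κ * (1 + x ^ (κ - 1) + b ^ (κ - 1)) := by
    have hm : 0 ≤ max x b := hx.trans (le_max_left _ _)
    have h1 : (max x b) ^ (p - 1) ≤ 1 + x ^ (κ - 1) + b ^ (κ - 1) := by
      have h3 := rpow_le_one_add_rpow hx (sub_nonneg.2 hp1) (sub_le_sub_right hpκ 1)
      have h4 := rpow_le_one_add_rpow hb (sub_nonneg.2 hp1) (sub_le_sub_right hpκ 1)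
      have h5 := Real.rpow_nonneg hb (κ - 1)
      rcases max_choice x b with h | h <;> rw [h] <;> linarith
    have h2 : (2 : ℝ) ^ (p - 1) ≤ 2 ^ κ :=
      Real.rpow_le_rpow_of_exponent_le one_le_two (by linarith)
    calc (x + b) ^ (p - 1) ≤ (2 * max x b) ^ (p - 1) :=
          Real.rpow_le_rpow (by linarith)
            (by linarith [le_max_left x b, le_max_right x b]) (by linarith)
      _ = 2 ^ (p - 1) * (max x b) ^ (p - 1) := Real.mul_rpow zero_le_two hm
      _ ≤ 2 ^ κ * (1 + x ^ (κ - 1) + b ^ (κ - 1)) :=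
          mul_le_mul h2 h1 (Real.rpow_nonneg hm _) h2κ
  calc (x + b) ^ p - x ^ p ≤ p * b * (x + b) ^ (p - 1) := add_rpow_sub_rpow_le_mul hx hb hp1
    _ ≤ κ * b * (2 ^ κ * (1 + x ^ (κ - 1) + b ^ (κ - 1))) := by
        refine mul_le_mul (mul_le_mul_of_nonneg_right hpκ hb) hpow
          (Real.rpow_nonneg (add_nonneg hx hb) _) (mul_nonneg (by linarith) hb)
    _ = κ * 2 ^ κ * (b + b * x ^ (κ - 1) + b * b ^ (κ - 1)) := by ring
    _ = _ := by rw [hbb]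

lemma mul_rpow_sub_one_le {a b : ℝ} (ha : 0 ≤ a) (hb : 0 ≤ b) (hκ : 1 < κ) :
    b * a ^ (κ - 1) ≤ a ^ κ + b ^ κ := by
  have hκ' : 0 ≤ κ - 1 := by linarith
  rcases le_total a b with h | h
  · have := mul_le_mul_of_nonneg_left (Real.rpow_le_rpow ha h hκ') hb
    rw [mul_rpow_sub_one_self hb (by linarith)] at this
    linarith [Real.rpow_nonneg ha κ]
  · have := mul_le_mul_of_nonneg_right h (Real.rpow_nonneg ha (κ - 1))
    rw [mul_rpow_sub_one_self ha (by linarith)] at this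
    linarith [Real.rpow_nonneg hb κ]

/-- An integrable majorant of `(AU + B) ^ p - (AU) ^ p`, uniform for `p` close to `κ`. -/
lemma exists_integrable_bound_increment [IsProbabilityMeasure μ]
    (hA : Measurable A) (hB : Measurable B)
    (hA0 : ∀ ω, 0 ≤ A ω) (hB0 : ∀ ω, 0 ≤ B ω) (hU0 : ∀ ω, 0 ≤ U ω) (hκ : 0 < κ)
    (hAint : Integrable (fun ω => A ω ^ κ) μ) (hBint : Integrable (fun ω => B ω ^ κ) μ)
    (hindep : IndepFun U (fun ω => (A ω, B ω)) μ)
    (hUint : ∀ p, 0 < p → p < κ → Integrable (fun ω => U ω ^ p) μ) :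
    ∃ G : Ω → ℝ, Integrable G μ ∧ ∃ p₀, 0 < p₀ ∧ p₀ < κ ∧ ∀ p, p₀ < p → p ≤ κ → ∀ ω,
      (A ω * U ω + B ω) ^ p - (A ω * U ω) ^ p ≤ G ω := by
  have hAU0 : ∀ ω, 0 ≤ A ω * U ω := fun ω => mul_nonneg (hA0 ω) (hU0 ω)
  rcases le_or_gt κ 1 with h1 | h1
  · refine ⟨fun ω => 1 + B ω ^ κ, (integrable_const 1).add hBint, κ / 2, by positivity,
      by linarith, fun p hp hpκ ω => ?_⟩
    exact add_rpow_sub_rpow_le_of_le_one (hAU0 ω) (hB0 ω) (by linarith) (hpκ.trans h1) hpκ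
  · have hBA : Integrable (fun ω => B ω * A ω ^ (κ - 1)) μ := by
      refine (hAint.add hBint).mono' (hB.mul (hA.pow_const _)).aestronglyMeasurable
        (ae_of_all _ fun ω => ?_)
      rw [Real.norm_of_nonneg (mul_nonneg (hB0 ω) (Real.rpow_nonneg (hA0 ω) _))]
      exact mul_rpow_sub_one_le (hA0 ω) (hB0 ω) h1
    have hind : IndepFun (fun ω => B ω * A ω ^ (κ - 1)) (fun ω => U ω ^ (κ - 1)) μ :=
      hindep.symm.comp (φ := fun x : ℝ × ℝ => x.2 * x.1 ^ (κ - 1)) (ψ := fun x => x ^ (κ - 1))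
        (by fun_prop) (by fun_prop)
    have hBAU := hind.integrable_mul hBA (hUint (κ - 1) (by linarith) (by linarith))
    have hB1 : Integrable B μ := by
      simpa using integrable_rpow_of_le hB hB0 zero_le_one h1.le hBint
    refine ⟨fun ω => κ * 2 ^ κ * (B ω + B ω * (A ω * U ω) ^ (κ - 1) + B ω ^ κ), ?_, 1,
      one_pos, h1, fun p hp hpκ ω =>
        add_rpow_sub_rpow_le_of_one_le (hAU0 ω) (hB0 ω) hp.le hpκ⟩
    refine ((hB1.add ?_).add hBint).const_mul _
    refine hBAU.congr (ae_of_all _ fun ω => ?_)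
    simp only [Pi.mul_apply]
    rw [Real.mul_rpow (hA0 ω) (hU0 ω), mul_assoc]

lemma increment_nonneg {x b p : ℝ} (hx : 0 ≤ x) (hb : 0 ≤ b) (hp : 0 ≤ p) :
    0 ≤ (x + b) ^ p - x ^ p :=
  sub_nonneg.2 (Real.rpow_le_rpow hx (by linarith) hp)

lemma tendsto_integral_increment [IsProbabilityMeasure μ]
    (hA : Measurable A) (hB : Measurable B) (hU : Measurable U)
    (hA0 : ∀ ω, 0 ≤ A ω) (hB0 : ∀ ω, 0 ≤ B ω) (hU0 : ∀ ω, 0 ≤ U ω) (hκ : 0 < κ)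
    (hBne0 : μ {ω | B ω = 0} < 1)
    (hAint : Integrable (fun ω => A ω ^ κ) μ) (hBint : Integrable (fun ω => B ω ^ κ) μ)
    (hindep : IndepFun U (fun ω => (A ω, B ω)) μ)
    (hUint : ∀ p, 0 < p → p < κ → Integrable (fun ω => U ω ^ p) μ) :
    Tendsto (fun ε => ∫ ω, ((A ω * U ω + B ω) ^ (κ - ε) - (A ω * U ω) ^ (κ - ε)) ∂μ) (𝓝[>] 0)
      (𝓝 (∫ ω, ((A ω * U ω + B ω) ^ κ - (A ω * U ω) ^ κ) ∂μ)) ∧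
    0 < ∫ ω, ((A ω * U ω + B ω) ^ κ - (A ω * U ω) ^ κ) ∂μ := by
  obtain ⟨G, hG, p₀, hp₀, hp₀κ, hbound⟩ :=
    exists_integrable_bound_increment hA hB hA0 hB0 hU0 hκ hAint hBint hindep hUint
  have hAU0 : ∀ ω, 0 ≤ A ω * U ω := fun ω => mul_nonneg (hA0 ω) (hU0 ω)
  have hmeas : ∀ p : ℝ, Measurable fun ω => (A ω * U ω + B ω) ^ p - (A ω * U ω) ^ p :=
    fun p => by fun_prop
  have hnorm : ∀ p, p₀ < p → p ≤ κ → ∀ ω,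
      ‖(A ω * U ω + B ω) ^ p - (A ω * U ω) ^ p‖ ≤ G ω := fun p hp hpκ ω => by
    rw [Real.norm_of_nonneg (increment_nonneg (hAU0 ω) (hB0 ω) (hp₀.trans hp).le)]
    exact hbound p hp hpκ ω
  constructor
  · refine tendsto_integral_filter_of_dominated_convergence G
      (Eventually.of_forall fun ε => (hmeas _).aestronglyMeasurable) ?_ hG
      (ae_of_all _ fun ω => ?_)
    · filter_upwards [Ioo_mem_nhdsGT (sub_pos.2 hp₀κ)] with ε hε
      exact ae_of_all _ (hnorm _ (by linarith [hε.2]) (by linarith [hε.1]))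
    · have hsub : Tendsto (fun ε : ℝ => κ - ε) (𝓝[>] 0) (𝓝 κ) := by
        have : Tendsto (fun ε : ℝ => κ - ε) (𝓝 0) (𝓝 (κ - 0)) :=
          (continuous_const.sub continuous_id).tendsto 0
        rw [sub_zero] at this
        exact this.mono_left nhdsWithin_le_nhds
      exact ((Real.continuousAt_const_rpow' hκ.ne').tendsto.comp hsub).sub
        ((Real.continuousAt_const_rpow' hκ.ne').tendsto.comp hsub)
  · have hint : Integrable (fun ω => (A ω * U ω + B ω) ^ κ - (A ω * U ω) ^ κ) μ :=
      hG.mono' (hmeas κ).aestronglyMeasurable (ae_of_all _ (hnorm κ hp₀κ le_rfl))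
    refine (integral_pos_iff_support_of_nonneg
      (fun ω => increment_nonneg (hAU0 ω) (hB0 ω) hκ.le) hint).2 ?_
    have hsub : {ω | B ω = 0}ᶜ ⊆
        Function.support fun ω => (A ω * U ω + B ω) ^ κ - (A ω * U ω) ^ κ := by
      intro ω h
      have hpos : 0 < B ω := (hB0 ω).lt_of_ne' h
      exact (sub_pos.2 (Real.rpow_lt_rpow (hAU0 ω) (by linarith) hκ)).ne'
    refine lt_of_lt_of_le ?_ (measure_mono hsub)
    rw [prob_compl_eq_one_sub (measurableSet_eq_fun hB measurable_const)]
    exact tsub_pos_of_lt hBne0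

end Increment

section Perpetuity

variable {Ω : Type*} [MeasurableSpace Ω] {μ : Measure Ω} {A B U : Ω → ℝ} {κ : ℝ}

/-- A solution of `U =_d AU + B` has finite moments of all orders below `κ`. -/
lemma integrable_rpow_of_perpetuity [IsProbabilityMeasure μ]
    (hA : Measurable A) (hB : Measurable B) (hU : Measurable U)
    (hA0 : ∀ ω, 0 ≤ A ω) (hB0 : ∀ ω, 0 ≤ B ω) (hU0 : ∀ ω, 0 ≤ U ω)
    (hAne1 : μ {ω | A ω = 1} < 1)
    (hAint : Integrable (fun ω => A ω ^ κ) μ) (hAκ : ∫ ω, A ω ^ κ ∂μ = 1)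
    (hBint : Integrable (fun ω => B ω ^ κ) μ)
    (hindep : IndepFun U (fun ω => (A ω, B ω)) μ)
    (hfix : μ.map U = μ.map (fun ω => A ω * U ω + B ω)) {p : ℝ} (hp : 0 < p) (hpκ : p < κ) :
    Integrable (fun ω => U ω ^ p) μ := by
  set a : Ω → ENNReal := fun ω => ENNReal.ofReal (A ω) with ha
  set b : Ω → ENNReal := fun ω => ENNReal.ofReal (B ω) with hb
  set u : Ω → ENNReal := fun ω => ENNReal.ofReal (U ω) with hu
  have hau : (fun ω => a ω * u ω + b ω) = fun ω => ENNReal.ofReal (A ω * U ω + B ω) := by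
    funext ω
    rw [ENNReal.ofReal_add (mul_nonneg (hA0 ω) (hU0 ω)) (hB0 ω), ENNReal.ofReal_mul (hA0 ω)]
  have hfix' : μ.map u = μ.map (fun ω => a ω * u ω + b ω) := by
    have h := congrArg (Measure.map ENNReal.ofReal) hfix
    rw [Measure.map_map ENNReal.measurable_ofReal hU,
      Measure.map_map ENNReal.measurable_ofReal (by fun_prop)] at h
    rw [hau]
    exact h
  have hind : IndepFun u a μ :=
    hindep.comp (φ := ENNReal.ofReal) (ψ := fun x : ℝ × ℝ => ENNReal.ofReal x.1)
      (by fun_prop) (by fun_prop)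
  have hlint : ∀ {f : Ω → ℝ}, (∀ ω, 0 ≤ f ω) → ∀ {r : ℝ}, 0 < r →
      ∫⁻ ω, ENNReal.ofReal (f ω) ^ r ∂μ = ∫⁻ ω, ENNReal.ofReal (f ω ^ r) ∂μ := fun hf r hr =>
    lintegral_congr fun ω => ENNReal.ofReal_rpow_of_nonneg (hf ω) hr.le
  have haq : ∀ r, 0 < r → r < κ → ∫⁻ ω, a ω ^ r ∂μ < 1 := by
    intro r hr hrκ
    rw [hlint hA0 hr, ← ofReal_integral_eq_lintegral_ofReal
      (integrable_rpow_of_le hA hA0 hr.le hrκ.le hAint)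
      (ae_of_all _ fun ω => Real.rpow_nonneg (hA0 ω) r), ENNReal.ofReal_lt_one]
    exact integral_rpow_lt_one hA hA0 hAne1 hAint hAκ hr hrκ
  have hbq : ∀ r, 0 < r → r < κ → ∫⁻ ω, b ω ^ r ∂μ ≠ ⊤ := by
    intro r hr hrκ
    rw [hlint hB0 hr]
    exact (integrable_rpow_of_le hB hB0 hr.le hrκ.le hBint).lintegral_lt_top.ne
  have hq : 0 < min p 1 := lt_min hp one_pos
  have hqκ : min p 1 < κ := (min_le_left _ _).trans_lt hpκ
  have huq := lintegral_rpow_ne_top_of_le_one (hU.ennreal_ofReal) hA.ennreal_ofReal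
    hB.ennreal_ofReal hind hfix' (fun ω => ENNReal.ofReal_ne_top) hq (min_le_right _ _)
    (haq _ hq hqκ) (hbq _ hq hqκ)
  have hup := lintegral_rpow_ne_top_of_lintegral_rpow_ne_top (hU.ennreal_ofReal)
    hA.ennreal_ofReal hB.ennreal_ofReal hind hfix' (fun ω => ENNReal.ofReal_ne_top) hq
    (min_le_left _ _) (haq _ hq hqκ) (haq _ hp hpκ) (hbq _ hp hpκ) huq
  rw [hlint hU0 hp] at hup
  exact ⟨(hU.pow_const p).aestronglyMeasurable, (hasFiniteIntegral_iff_ofReal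
    (ae_of_all _ fun ω => Real.rpow_nonneg (hU0 ω) p)).2 hup.lt_top⟩

lemma integral_rpow_mul_one_sub_eq
    (hA : Measurable A) (hB : Measurable B) (hU : Measurable U)
    (hA0 : ∀ ω, 0 ≤ A ω) (hU0 : ∀ ω, 0 ≤ U ω)
    (hindep : IndepFun U (fun ω => (A ω, B ω)) μ)
    (hfix : μ.map U = μ.map (fun ω => A ω * U ω + B ω)) {p : ℝ}
    (hAp : Integrable (fun ω => A ω ^ p) μ) (hUp : Integrable (fun ω => U ω ^ p) μ) :
    (∫ ω, U ω ^ p ∂μ) * (1 - ∫ ω, A ω ^ p ∂μ)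
      = ∫ ω, ((A ω * U ω + B ω) ^ p - (A ω * U ω) ^ p) ∂μ := by
  have hident : IdentDistrib (fun ω => U ω ^ p) (fun ω => (A ω * U ω + B ω) ^ p) μ μ :=
    IdentDistrib.comp (u := fun x : ℝ => x ^ p)
      ⟨hU.aemeasurable, by fun_prop, hfix⟩ (by fun_prop)
  have hind : IndepFun (fun ω => A ω ^ p) (fun ω => U ω ^ p) μ :=
    hindep.symm.comp (φ := fun x : ℝ × ℝ => x.1 ^ p) (ψ := fun x => x ^ p)
      (by fun_prop) (by fun_prop)
  have hmul : (fun ω => (A ω * U ω) ^ p) = fun ω => A ω ^ p * U ω ^ p :=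
    funext fun ω => Real.mul_rpow (hA0 ω) (hU0 ω)
  have hintAU : Integrable (fun ω => (A ω * U ω) ^ p) μ := by
    rw [hmul]
    exact hind.integrable_mul hAp hUp
  rw [integral_sub (hident.integrable_iff.1 hUp) hintAU, ← hident.integral_eq, hmul,
    hind.integral_fun_mul_eq_mul_integral hAp.aestronglyMeasurable hUp.aestronglyMeasurable]
  ring

lemma rpow_mul_exp_neg_posLog_le {x ε : ℝ} (hx : 0 ≤ x) (hκ : 0 < κ) (hε : 0 < ε) :
    x ^ κ * Real.exp (-(ε * max (Real.log x) 0)) ≤ 1 + x ^ (κ - ε) := by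
  rcases le_or_gt x 1 with h | h
  · have h1 := Real.rpow_le_one hx h hκ.le
    have h2 : Real.exp (-(ε * max (Real.log x) 0)) ≤ 1 :=
      Real.exp_le_one_iff.2 (neg_nonpos.2 (mul_nonneg hε.le (le_max_right _ _)))
    have := mul_le_one₀ h1 (Real.exp_pos _).le h2
    linarith [Real.rpow_nonneg hx (κ - ε)]
  · have hx0 : 0 < x := by linarith
    rw [max_eq_left (Real.log_nonneg h.le), sub_eq_add_neg, Real.rpow_add hx0,
      Real.rpow_def_of_pos hx0 (-ε), mul_neg, mul_comm (Real.log x)]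
    linarith

lemma rpow_sub_le_rpow_mul_exp_neg_posLog {x ε : ℝ} (hx : 0 ≤ x) (hεκ : ε < κ) :
    x ^ (κ - ε) ≤ 1 + x ^ κ * Real.exp (-(ε * max (Real.log x) 0)) := by
  rcases le_or_gt x 1 with h | h
  · have h1 := Real.rpow_le_one hx h (sub_nonneg.2 hεκ.le)
    have := mul_nonneg (Real.rpow_nonneg hx κ) (Real.exp_pos (-(ε * max (Real.log x) 0))).le
    linarith
  · have hx0 : 0 < x := by linarith
    rw [max_eq_left (Real.log_nonneg h.le), sub_eq_add_neg, Real.rpow_add hx0,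
      Real.rpow_def_of_pos hx0 (-ε), mul_neg, mul_comm (Real.log x)]
    linarith

/-- The truncated moment asymptotics for a solution that is nonnegative everywhere. -/
theorem tendsto_truncated_moment_div_log [IsProbabilityMeasure μ]
    (hA : Measurable A) (hB : Measurable B) (hU : Measurable U)
    (hA0 : ∀ ω, 0 ≤ A ω) (hB0 : ∀ ω, 0 ≤ B ω) (hU0 : ∀ ω, 0 ≤ U ω) (hκ : 0 < κ)
    (hAne1 : μ {ω | A ω = 1} < 1) (hBne0 : μ {ω | B ω = 0} < 1)
    (hAint : Integrable (fun ω => A ω ^ κ) μ) (hAκ : ∫ ω, A ω ^ κ ∂μ = 1)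
    (hBint : Integrable (fun ω => B ω ^ κ) μ)
    (hindep : IndepFun U (fun ω => (A ω, B ω)) μ)
    (hfix : μ.map U = μ.map (fun ω => A ω * U ω + B ω))
    (hlogplus : Integrable (fun ω => A ω ^ κ * max (Real.log (A ω)) 0) μ) :
    Tendsto (fun t : ℝ => (∫ ω, (if U ω ≤ t then U ω ^ κ else 0) ∂μ) /
        ((∫ ω, ((A ω * U ω + B ω) ^ κ - (A ω * U ω) ^ κ) ∂μ) /
            (∫ ω, A ω ^ κ * Real.log (A ω) ∂μ) * Real.log t)) atTop (𝓝 1) := by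
  have hUint : ∀ p, 0 < p → p < κ → Integrable (fun ω => U ω ^ p) μ := fun p hp hpκ =>
    integrable_rpow_of_perpetuity hA hB hU hA0 hB0 hU0 hAne1 hAint hAκ hBint hindep hfix hp hpκ
  obtain ⟨hC, hCpos⟩ :=
    tendsto_integral_increment hA hB hU hA0 hB0 hU0 hκ hBne0 hAint hBint hindep hUint
  have hm := tendsto_one_sub_integral_rpow_div hA hA0 hκ hAint hAκ hlogplus
  have hmpos := integral_rpow_mul_log_pos hA hA0 hκ hAne1 hAint hAκ hlogplus
  set C := ∫ ω, ((A ω * U ω + B ω) ^ κ - (A ω * U ω) ^ κ) ∂μ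
  set m := ∫ ω, A ω ^ κ * Real.log (A ω) ∂μ
  have hcpos : 0 < C / m := div_pos hCpos hmpos
  have hmoment : Tendsto (fun ε => ε * ∫ ω, U ω ^ (κ - ε) ∂μ) (𝓝[>] 0) (𝓝 (C / m)) := by
    refine (hC.div hm hmpos.ne').congr' ?_
    filter_upwards [Ioo_mem_nhdsGT hκ] with ε hε
    have hε0 : 0 < ε := hε.1
    have hlt := integral_rpow_lt_one hA hA0 hAne1 hAint hAκ (q := κ - ε) (by linarith [hε.2])
      (by linarith)
    have hne : 1 - ∫ ω, A ω ^ (κ - ε) ∂μ ≠ 0 := by linarith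
    simp only [Pi.div_apply]
    rw [← integral_rpow_mul_one_sub_eq hA hB hU hA0 hU0 hindep hfix
      (integrable_rpow_of_le hA hA0 (by linarith [hε.2]) (by linarith) hAint)
      (hUint _ (by linarith [hε.2]) (by linarith))]
    field_simp
  set L : Ω → ℝ := fun ω => max (Real.log (U ω)) 0 with hL
  have hLmeas : Measurable L := by fun_prop
  have hL0 : ∀ ω, 0 ≤ L ω := fun ω => le_max_right _ _
  have hw0 : ∀ ω, 0 ≤ U ω ^ κ := fun ω => Real.rpow_nonneg (hU0 ω) κ
  have hint : ∀ ε > 0, Integrable (fun ω => U ω ^ κ * Real.exp (-(ε * L ω))) μ := by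
    intro ε hε
    set ε' := min ε (κ / 2)
    have hε'0 : 0 < ε' := lt_min hε (by positivity)
    have hε'κ : ε' < κ := (min_le_right _ _).trans_lt (by linarith)
    refine ((integrable_const 1).add (hUint (κ - ε') (by linarith) (by linarith))).mono'
      (by fun_prop) (ae_of_all _ fun ω => ?_)
    rw [Real.norm_of_nonneg (mul_nonneg (hw0 ω) (Real.exp_pos _).le)]
    refine le_trans (mul_le_mul_of_nonneg_left ?_ (hw0 ω))
      (rpow_mul_exp_neg_posLog_le (hU0 ω) hκ hε'0)
    exact Real.exp_le_exp.2 (neg_le_neg (mul_le_mul_of_nonneg_right (min_le_left _ _) (hL0 ω)))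
  have hlaplace : Tendsto (fun ε => ε * ∫ ω, U ω ^ κ * Real.exp (-(ε * L ω)) ∂μ) (𝓝[>] 0)
      (𝓝 (C / m)) := by
    have hid : Tendsto (fun ε : ℝ => ε) (𝓝[>] 0) (𝓝 0) := nhdsWithin_le_nhds
    have hlow := hmoment.sub hid
    have hup := hmoment.add hid
    rw [sub_zero] at hlow
    rw [add_zero] at hup
    refine tendsto_of_tendsto_of_tendsto_of_le_of_le' hlow hup ?_ ?_
    · filter_upwards [Ioo_mem_nhdsGT hκ] with ε hε
      have hε0 : 0 < ε := hε.1
      have h := integral_mono (hUint (κ - ε) (by linarith [hε.2]) (by linarith))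
        ((integrable_const 1).add (hint ε hε0)) fun ω =>
          rpow_sub_le_rpow_mul_exp_neg_posLog (hU0 ω) hε.2
      rw [integral_add' (integrable_const 1) (hint ε hε0)] at h
      simp only [integral_const, probReal_univ, smul_eq_mul, one_mul] at h
      linarith [mul_le_mul_of_nonneg_left h hε0.le]
    · filter_upwards [Ioo_mem_nhdsGT hκ] with ε hε
      have hε0 : 0 < ε := hε.1
      have hUε := hUint (κ - ε) (by linarith [hε.2]) (by linarith)
      have h := integral_mono (hint ε hε0) ((integrable_const 1).add hUε) fun ω =>
          rpow_mul_exp_neg_posLog_le (hU0 ω) hκ hε0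
      rw [integral_add' (integrable_const 1) hUε] at h
      simp only [integral_const, probReal_univ, smul_eq_mul, one_mul] at h
      linarith [mul_le_mul_of_nonneg_left h hε0.le]
  have hkar := (tendsto_truncated_integral_of_tendsto_laplace (by fun_prop) hLmeas hw0 hL0 hint
    hlaplace).comp Real.tendsto_log_atTop
  have hfinal := hkar.div_const (C / m)
  rw [div_self hcpos.ne'] at hfinal
  refine hfinal.congr' ?_
  filter_upwards [eventually_gt_atTop 1] with t ht
  have hlog : 0 < Real.log t := Real.log_pos ht
  have hiff : ∀ ω, L ω ≤ Real.log t ↔ U ω ≤ t := by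
    intro ω
    rw [hL, max_le_iff, and_iff_left hlog.le]
    rcases (hU0 ω).eq_or_lt with h | h
    · rw [← h, Real.log_zero]
      exact ⟨fun _ => by linarith, fun _ => hlog.le⟩
    · exact Real.log_le_log_iff h (by linarith)
  simp only [Function.comp_apply, hiff]
  field_simp

end Perpetuity

/-- Truncated moments of perpetuities in the classical case `E[A^κ ln⁺ A] < ∞`:
`E[U^κ 1{U ≤ t}] ≍ (E[(AU+B)^κ − (AU)^κ] / E[A^κ ln A]) · ln t` as `t → ∞`. -/
theorem truncated_moment_asymptotics_finite_case
    {Ω : Type*} [MeasurableSpace Ω] (μ : Measure Ω) [IsProbabilityMeasure μ]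
    (A B U : Ω → ℝ) (κ : ℝ)
    (hA : Measurable A) (hB : Measurable B) (hU : Measurable U)
    (hA0 : ∀ ω, 0 ≤ A ω) (hB0 : ∀ ω, 0 ≤ B ω) (hU0 : ∀ᵐ ω ∂μ, 0 ≤ U ω)
    (hκ : 0 < κ)
    (hAne1 : μ {ω | A ω = 1} < 1)
    (hBne0 : μ {ω | B ω = 0} < 1)
    (hAκint : Integrable (fun ω => A ω ^ κ) μ)
    (hAκ : ∫ ω, A ω ^ κ ∂μ = 1)
    (hBκ : Integrable (fun ω => B ω ^ κ) μ)
    (hindep : IndepFun U (fun ω => (A ω, B ω)) μ)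
    (hfix : Measure.map U μ = Measure.map (fun ω => A ω * U ω + B ω) μ)
    (hlogplus : Integrable (fun ω => A ω ^ κ * max (Real.log (A ω)) 0) μ) :
    Filter.Tendsto
      (fun t : ℝ =>
        (∫ ω, (if U ω ≤ t then U ω ^ κ else 0) ∂μ) /
          ((∫ ω, ((A ω * U ω + B ω) ^ κ - (A ω * U ω) ^ κ) ∂μ) /
            (∫ ω, A ω ^ κ * Real.log (A ω) ∂μ) * Real.log t))
      Filter.atTop (nhds 1) := by
  set V : Ω → ℝ := fun ω => max (U ω) 0 with hV
  have hVU : U =ᵐ[μ] V := hU0.mono fun ω h => (max_eq_left h).symm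
  have hfixV : μ.map V = μ.map (fun ω => A ω * V ω + B ω) := by
    rw [← Measure.map_congr hVU, hfix]
    exact Measure.map_congr (hVU.mono fun ω h => by simp only [h])
  have hmain := tendsto_truncated_moment_div_log hA hB (hU.max measurable_const) hA0 hB0
    (fun ω => le_max_right (U ω) 0) hκ hAne1 hBne0 hAκint hAκ hBκ
    (hindep.congr hVU (ae_eq_refl _)) hfixV hlogplus
  have hC : ∫ ω, ((A ω * U ω + B ω) ^ κ - (A ω * U ω) ^ κ) ∂μ
      = ∫ ω, ((A ω * V ω + B ω) ^ κ - (A ω * V ω) ^ κ) ∂μ :=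
    integral_congr_ae (hVU.mono fun ω h => by simp only [h])
  have hF : ∀ t : ℝ, ∫ ω, (if U ω ≤ t then U ω ^ κ else 0) ∂μ
      = ∫ ω, (if V ω ≤ t then V ω ^ κ else 0) ∂μ := fun t =>
    integral_congr_ae (hVU.mono fun ω h => by simp only [h])
  simp only [hC, hF]
  exact hmain
end

section
/- Let {Y_j}_{j≥1} be nonnegative random variables, identically distributed as Y, such that ℓ(x) = E[Y 1{Y ≤ x}] is slowly varying and satisfies both ℓ(x ℓ(x))/ℓ(x) → 1 and ℓ(x/ln x)/ℓ(x) → 1 as x → ∞. Suppose there exist η ∈ [0,1), h₀ > 0 and C_∞ > 0 such that for all i,j ∈ ℕ and all h ≥ h₀: E[χ_h(Y_i) χ_h(Y_j)] − E[χ_h(Y_i)] E[χ_h(Y_j)] ≤ C_∞ h² η^{|j−i|}. Then (Y_1 + Y_2 + … + Y_n)/(n ℓ(n)) converges in probability to 1. -/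
open MeasureTheory Filter Topology

/-- A measurable function `ℓ` is slowly varying if it is eventually positive and
`ℓ(t x)/ℓ(x) → 1` as `x → ∞` for every `t > 0`. -/
def SlowlyVarying (f : ℝ → ℝ) : Prop :=
  (∀ᶠ x in Filter.atTop, 0 < f x) ∧
    ∀ t : ℝ, 0 < t → Filter.Tendsto (fun x => f (t * x) / f x) Filter.atTop (nhds 1)

/-- The truncation at level `h`: `χ_h(x) = x` if `|x| < h`, `h` if `x ≥ h`, `−h` if `x ≤ −h`. -/
def truncAt (h x : ℝ) : ℝ := max (-h) (min x h)

/-- The truncated mean `E[X 1{X ≤ x}]`. -/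
noncomputable def truncMean {Ω : Type*} [MeasurableSpace Ω] (μ : Measure Ω) (X : Ω → ℝ)
    (x : ℝ) : ℝ :=
  ∫ ω, (if X ω ≤ x then X ω else 0) ∂μ

/-- The tail probability `P(X > x)`. -/
noncomputable def tailProb {Ω : Type*} [MeasurableSpace Ω] (μ : Measure Ω) (X : Ω → ℝ)
    (x : ℝ) : ℝ :=
  μ.real {ω | x < X ω}

lemma truncAt_of_le {h y : ℝ} (hh : 0 ≤ h) (hy0 : 0 ≤ y) (hy : y ≤ h) : truncAt h y = y := by
  rw [truncAt, min_eq_left hy, max_eq_right (by linarith)]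

lemma truncAt_of_ge {h y : ℝ} (hh : 0 ≤ h) (hy : h ≤ y) : truncAt h y = h := by
  rw [truncAt, min_eq_right hy, max_eq_right (by linarith)]

lemma measurable_truncAt (h : ℝ) : Measurable (truncAt h) := by
  unfold truncAt
  fun_prop

lemma truncAt_nonneg {h y : ℝ} (hh : 0 ≤ h) (hy : 0 ≤ y) : 0 ≤ truncAt h y :=
  le_max_of_le_right (le_min hy hh)

lemma truncAt_le {h : ℝ} (hh : 0 ≤ h) (y : ℝ) : truncAt h y ≤ h :=
  max_le (by linarith) (min_le_right _ _)

section Truncation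

variable {Ω : Type*} [MeasurableSpace Ω] {μ : Measure Ω} {X : Ω → ℝ}

lemma tailProb_nonneg (x : ℝ) : 0 ≤ tailProb μ X x := measureReal_nonneg

lemma tailProb_eq_integral (hX : Measurable X) (x : ℝ) :
    tailProb μ X x = ∫ ω, (if x < X ω then (1 : ℝ) else 0) ∂μ := by
  rw [tailProb, ← integral_indicator_one (measurableSet_lt measurable_const hX)]
  refine integral_congr_ae (Eventually.of_forall fun ω => ?_)
  simp [Set.indicator_apply]

variable [IsProbabilityMeasure μ]

lemma integrable_comp_of_bdd_on_nonneg (hX : Measurable X) (hX0 : ∀ ω, 0 ≤ X ω) {g : ℝ → ℝ}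
    (hg : Measurable g) (C : ℝ) (hC : ∀ y, 0 ≤ y → |g y| ≤ C) :
    Integrable (fun ω => g (X ω)) μ :=
  Integrable.of_bound (hg.comp hX).aestronglyMeasurable C
    (Eventually.of_forall fun ω => hC _ (hX0 ω))

lemma integrable_ite_le (hX : Measurable X) (hX0 : ∀ ω, 0 ≤ X ω) (x : ℝ) :
    Integrable (fun ω => if X ω ≤ x then X ω else 0) μ := by
  refine integrable_comp_of_bdd_on_nonneg (g := fun y => if y ≤ x then y else 0) hX hX0
    (Measurable.ite measurableSet_Iic measurable_id measurable_const) |x| fun y hy => ?_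
  split_ifs with h
  · exact abs_le_abs_of_nonneg hy h
  · simp

lemma integrable_ite_lt (hX : Measurable X) (hX0 : ∀ ω, 0 ≤ X ω) (x : ℝ) :
    Integrable (fun ω => if x < X ω then (1 : ℝ) else 0) μ := by
  refine integrable_comp_of_bdd_on_nonneg (g := fun y => if x < y then (1 : ℝ) else 0) hX hX0
    (Measurable.ite measurableSet_Ioi measurable_const measurable_const) 1 fun y hy => ?_
  split_ifs <;> simp

lemma truncMean_mono (hX : Measurable X) (hX0 : ∀ ω, 0 ≤ X ω) : Monotone (truncMean μ X) := by
  intro x y hxy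
  refine integral_mono (integrable_ite_le hX hX0 x) (integrable_ite_le hX hX0 y) fun ω => ?_
  have := hX0 ω
  dsimp only
  split_ifs <;> linarith

lemma mul_tailProb_sub_le (hX : Measurable X) (hX0 : ∀ ω, 0 ≤ X ω) {x : ℝ} (hx : 0 < x) :
    x * (tailProb μ X x - tailProb μ X (2 * x)) ≤ truncMean μ X (2 * x) - truncMean μ X x := by
  have h1 := integrable_ite_lt (μ := μ) hX hX0 x
  have h2 := integrable_ite_lt (μ := μ) hX hX0 (2 * x)
  have h3 := integrable_ite_le (μ := μ) hX hX0 x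
  have h4 := integrable_ite_le (μ := μ) hX hX0 (2 * x)
  rw [tailProb_eq_integral hX, tailProb_eq_integral hX, truncMean, truncMean,
    ← integral_sub h1 h2, ← integral_const_mul, ← integral_sub h4 h3]
  refine integral_mono ((h1.sub h2).const_mul x) (h4.sub h3) fun ω => ?_
  have := hX0 ω
  dsimp only
  split_ifs <;> linarith

lemma tendsto_tailProb_atTop (hX : Measurable X) : Tendsto (tailProb μ X) atTop (𝓝 0) := by
  have h : ∀ x, tailProb μ X x = 1 - ProbabilityTheory.cdf (μ.map X) x := by
    intro x
    have : IsProbabilityMeasure (μ.map X) := Measure.isProbabilityMeasure_map hX.aemeasurable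
    rw [ProbabilityTheory.cdf_eq_real, map_measureReal_apply hX measurableSet_Iic,
      ← probReal_compl_eq_one_sub (hX measurableSet_Iic), tailProb]
    congr 1
    ext ω
    simp
  have := (ProbabilityTheory.tendsto_cdf_atTop (μ.map X)).const_sub 1
  rw [sub_self] at this
  exact this.congr fun x => (h x).symm

/-- If the truncated mean is slowly varying, then `x P(X > x) = o(E[X 1{X ≤ x}])`. -/
lemma tendsto_mul_tailProb_div_truncMean (hX : Measurable X) (hX0 : ∀ ω, 0 ≤ X ω)
    (hsv : SlowlyVarying (truncMean μ X)) :
    Tendsto (fun x => x * tailProb μ X x / truncMean μ X x) atTop (𝓝 0) := by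
  rw [Metric.tendsto_atTop']
  intro ε hε
  set δ := min (ε / 8) (1 / 2) with hδ
  have hδ0 : 0 < δ := by positivity
  have hδ1 : δ ≤ 1 / 2 := min_le_right _ _
  have hδ2 : δ ≤ ε / 8 := min_le_left _ _
  have hev : ∀ᶠ x in atTop, 0 < x ∧ 0 < truncMean μ X x ∧
      truncMean μ X (2 * x) ≤ (1 + δ) * truncMean μ X x := by
    filter_upwards [eventually_gt_atTop 0, hsv.1,
      (hsv.2 2 two_pos).eventually (eventually_le_nhds (show (1 : ℝ) < 1 + δ by linarith))]
      with x hx hx1 hx2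
    exact ⟨hx, hx1, (div_le_iff₀ hx1).1 hx2⟩
  obtain ⟨x₀, hx₀⟩ := eventually_atTop.1 hev
  have key : ∀ N : ℕ, ∀ x, x₀ ≤ x →
      tailProb μ X x ≤ 4 * δ * (truncMean μ X x / x) + tailProb μ X (2 ^ N * x) := by
    intro N
    induction N with
    | zero =>
      intro x hx
      obtain ⟨h0, h1, -⟩ := hx₀ x hx
      have : 0 ≤ 4 * δ * (truncMean μ X x / x) := by positivity
      simpa using this
    | succ N ih =>
      intro x hx
      obtain ⟨h0, h1, h2⟩ := hx₀ x hx
      have h3 := ih (2 * x) (by linarith)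
      have h4 := mul_tailProb_sub_le (μ := μ) hX hX0 h0
      have h5 : tailProb μ X x - tailProb μ X (2 * x) ≤ δ * (truncMean μ X x / x) := by
        rw [← mul_div_assoc, le_div_iff₀ h0]
        linarith
      have h6 : truncMean μ X (2 * x) / (2 * x) ≤ (3 / 4) * (truncMean μ X x / x) := by
        rw [← mul_div_assoc, div_le_div_iff₀ (by linarith) h0]
        have : truncMean μ X (2 * x) ≤ (3 / 2) * truncMean μ X x := by nlinarith
        nlinarith
      have h7 : 2 ^ (N + 1) * x = 2 ^ N * (2 * x) := by ring
      rw [h7]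
      nlinarith
  refine ⟨x₀, fun x hx => ?_⟩
  obtain ⟨h0, h1, -⟩ := hx₀ x hx.le
  have hlim : Tendsto (fun N : ℕ => 4 * δ * (truncMean μ X x / x) + tailProb μ X (2 ^ N * x))
      atTop (𝓝 (4 * δ * (truncMean μ X x / x) + 0)) :=
    ((tendsto_tailProb_atTop hX).comp
      ((tendsto_pow_atTop_atTop_of_one_lt one_lt_two).atTop_mul_const h0)).const_add _
  have hle := ge_of_tendsto' hlim fun N => key N x hx.le
  have hnn : 0 ≤ x * tailProb μ X x / truncMean μ X x :=
    div_nonneg (mul_nonneg h0.le (tailProb_nonneg x)) h1.le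
  rw [Real.dist_eq, sub_zero, abs_of_nonneg hnn, div_lt_iff₀ h1]
  rw [add_zero, ← mul_div_assoc, le_div_iff₀ h0] at hle
  nlinarith

lemma integral_truncAt (hX : Measurable X) (hX0 : ∀ ω, 0 ≤ X ω) {h : ℝ} (hh : 0 < h) :
    ∫ ω, truncAt h (X ω) ∂μ = truncMean μ X h + h * tailProb μ X h := by
  have h1 := integrable_ite_lt (μ := μ) hX hX0 h
  have h3 := integrable_ite_le (μ := μ) hX hX0 h
  rw [tailProb_eq_integral hX, truncMean, ← integral_const_mul,
    ← integral_add h3 (h1.const_mul h)]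
  refine integral_congr_ae (Eventually.of_forall fun ω => ?_)
  dsimp only
  rcases le_or_gt (X ω) h with hle | hlt
  · rw [truncAt_of_le hh.le (hX0 ω) hle, if_pos hle, if_neg hle.not_gt]
    ring
  · rw [truncAt_of_ge hh.le hlt.le, if_pos hlt, if_neg hlt.not_ge]
    ring

lemma integral_sq_truncAt_le (hX : Measurable X) (hX0 : ∀ ω, 0 ≤ X ω) {h δ : ℝ} (hh : 0 < h)
    (hδ : 0 < δ) (hδ1 : δ ≤ 1) :
    ∫ ω, truncAt h (X ω) ^ 2 ∂μ ≤ δ * h * truncMean μ X h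
      + h * (truncMean μ X h - truncMean μ X (δ * h)) + h ^ 2 * tailProb μ X h := by
  have h1 := (integrable_ite_lt (μ := μ) hX hX0 h).const_mul (h ^ 2)
  have h2 := integrable_ite_le (μ := μ) hX hX0 (δ * h)
  have h3 := integrable_ite_le (μ := μ) hX hX0 h
  have h4 := h3.const_mul (δ * h)
  have h5 : Integrable (fun ω => h * ((if X ω ≤ h then X ω else 0)
      - if X ω ≤ δ * h then X ω else 0)) μ := (h3.sub h2).const_mul h
  rw [tailProb_eq_integral hX, truncMean, truncMean, ← integral_const_mul, ← integral_const_mul,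
    ← integral_sub h3 h2, ← integral_const_mul, ← integral_add h4 h5,
    ← integral_add (by exact h4.add h5) h1]
  have hsq : Integrable (fun ω => truncAt h (X ω) ^ 2) μ := by
    refine integrable_comp_of_bdd_on_nonneg (g := fun y => truncAt h y ^ 2) hX hX0
      ((measurable_truncAt h).pow_const 2) (h ^ 2) fun y hy => ?_
    rw [abs_of_nonneg (sq_nonneg _)]
    exact pow_le_pow_left₀ (truncAt_nonneg hh.le hy) (truncAt_le hh.le y) 2
  refine integral_mono hsq ((h4.add h5).add h1) fun ω => ?_
  have h0 := hX0 ω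
  have hδh : 0 < δ * h := by positivity
  have hδle : δ * h ≤ h := mul_le_of_le_one_left hh.le hδ1
  dsimp only [Pi.add_apply, Pi.sub_apply]
  rcases le_or_gt (X ω) h with hle | hlt
  · rw [truncAt_of_le hh.le h0 hle, if_pos hle, if_neg hle.not_gt]
    split_ifs with hd <;> nlinarith
  · rw [truncAt_of_ge hh.le hlt.le, if_pos hlt, if_neg hlt.not_ge]
    split_ifs with hd <;> nlinarith

lemma tendsto_integral_truncAt_div (hX : Measurable X) (hX0 : ∀ ω, 0 ≤ X ω)
    (hsv : SlowlyVarying (truncMean μ X)) :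
    Tendsto (fun h => (∫ ω, truncAt h (X ω) ∂μ) / truncMean μ X h) atTop (𝓝 1) := by
  have := (tendsto_mul_tailProb_div_truncMean hX hX0 hsv).const_add 1
  rw [add_zero] at this
  refine this.congr' ?_
  filter_upwards [hsv.1, eventually_gt_atTop 0] with h h1 h2
  rw [integral_truncAt hX hX0 h2, add_div, div_self h1.ne']

/-- If the truncated mean is slowly varying, then the second moment of the truncation at level `h`
is `o(h E[X 1{X ≤ h}])`. -/
lemma tendsto_integral_sq_truncAt_div (hX : Measurable X) (hX0 : ∀ ω, 0 ≤ X ω)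
    (hsv : SlowlyVarying (truncMean μ X)) :
    Tendsto (fun h => (∫ ω, truncAt h (X ω) ^ 2 ∂μ) / (h * truncMean μ X h)) atTop (𝓝 0) := by
  rw [tendsto_order]
  constructor
  · intro a ha
    filter_upwards [hsv.1, eventually_gt_atTop 0] with h h1 h2
    exact ha.trans_le (div_nonneg (integral_nonneg fun ω => sq_nonneg _) (mul_pos h2 h1).le)
  · intro a ha
    set δ := min (a / 2) 1 with hδ
    have hδ0 : 0 < δ := by positivity
    have hδa : δ ≤ a / 2 := min_le_left _ _
    have hlim : Tendsto (fun h => δ + (1 - truncMean μ X (δ * h) / truncMean μ X h)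
        + h * tailProb μ X h / truncMean μ X h) atTop (𝓝 (δ + (1 - 1) + 0)) :=
      (((hsv.2 δ hδ0).const_sub 1).const_add _).add
        (tendsto_mul_tailProb_div_truncMean hX hX0 hsv)
    filter_upwards [hsv.1, eventually_gt_atTop 0,
      hlim.eventually (eventually_lt_nhds (show δ + (1 - 1) + 0 < a by linarith))]
      with h h1 h2 h3
    refine lt_of_le_of_lt ?_ h3
    rw [div_le_iff₀ (mul_pos h2 h1)]
    refine (integral_sq_truncAt_le hX hX0 h2 hδ0 (min_le_right _ _)).trans_eq ?_
    field_simp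

end Truncation

section Sums

variable {Ω : Type*} [MeasurableSpace Ω] {μ : Measure Ω} [IsProbabilityMeasure μ]
  {Y : ℕ → Ω → ℝ}

lemma memLp_truncAt {X : Ω → ℝ} (hX : Measurable X) (hX0 : ∀ ω, 0 ≤ X ω) {h : ℝ} (hh : 0 < h) :
    MemLp (fun ω => truncAt h (X ω)) 2 μ :=
  MemLp.of_bound ((measurable_truncAt h).comp hX).aestronglyMeasurable h
    (Eventually.of_forall fun ω => by
      rw [Real.norm_eq_abs, abs_of_nonneg (truncAt_nonneg hh.le (hX0 ω))]
      exact truncAt_le hh.le _)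

lemma card_filter_dist_lt_le (n i m : ℕ) :
    ((Finset.Icc 1 n).filter fun j => Nat.dist i j < m).card ≤ 2 * m + 1 := by
  have hsub : ((Finset.Icc 1 n).filter fun j => Nat.dist i j < m) ⊆ Finset.Icc (i - m) (i + m) := by
    intro j hj
    have := (Finset.mem_filter.1 hj).2
    simp only [Nat.dist] at this
    rw [Finset.mem_Icc]
    omega
  refine (Finset.card_le_card hsub).trans ?_
  rw [Nat.card_Icc]
  omega

/-- Variance of a sum of truncations: pairs at distance less than `m` are bounded by the second
moment, the others by the exponential covariance bound. -/
lemma variance_sum_truncAt_le (hY : ∀ j, Measurable (Y j)) (hY0 : ∀ j ω, 0 ≤ Y j ω)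
    (hident : ∀ j, 1 ≤ j → ProbabilityTheory.IdentDistrib (Y j) (Y 1) μ μ)
    {h C ρ : ℝ} (hh : 0 < h) (hC : 0 ≤ C) (hρ0 : 0 ≤ ρ) (hρ1 : ρ ≤ 1)
    (hcov : ∀ i j : ℕ, 1 ≤ i → 1 ≤ j →
      (∫ ω, truncAt h (Y i ω) * truncAt h (Y j ω) ∂μ) -
        (∫ ω, truncAt h (Y i ω) ∂μ) * ∫ ω, truncAt h (Y j ω) ∂μ
        ≤ C * ρ ^ (Nat.dist i j)) (n m : ℕ) :
    ProbabilityTheory.variance (∑ j ∈ Finset.Icc 1 n, fun ω => truncAt h (Y j ω)) μ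
      ≤ n * ((2 * m + 1) * (∫ ω, truncAt h (Y 1 ω) ^ 2 ∂μ) + n * (C * ρ ^ m)) := by
  set V := ∫ ω, truncAt h (Y 1 ω) ^ 2 ∂μ with hV
  have hV0 : 0 ≤ V := integral_nonneg fun ω => sq_nonneg _
  have hL : ∀ j, MemLp (fun ω => truncAt h (Y j ω)) 2 μ := fun j =>
    memLp_truncAt (hY j) (hY0 j) hh
  have hsq : ∀ j, 1 ≤ j → ∫ ω, truncAt h (Y j ω) ^ 2 ∂μ = V := fun j hj =>
    ((hident j hj).comp ((measurable_truncAt h).pow_const 2)).integral_eq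
  have hpair : ∀ i j, 1 ≤ i → 1 ≤ j →
      (∫ ω, truncAt h (Y i ω) * truncAt h (Y j ω) ∂μ) -
        (∫ ω, truncAt h (Y i ω) ∂μ) * ∫ ω, truncAt h (Y j ω) ∂μ
        ≤ (if Nat.dist i j < m then V else 0) + C * ρ ^ m := by
    intro i j hi hj
    split_ifs with hd
    · have h1 : ∫ ω, truncAt h (Y i ω) * truncAt h (Y j ω) ∂μ ≤ V := by
        have h2 : V = ∫ ω, (truncAt h (Y i ω) ^ 2 + truncAt h (Y j ω) ^ 2) / 2 ∂μ := by
          rw [integral_div, integral_add (hL i).integrable_sq (hL j).integrable_sq, hsq i hi,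
            hsq j hj]
          ring
        rw [h2]
        refine integral_mono ((hL i).integrable_mul (hL j))
          (((hL i).integrable_sq.add (hL j).integrable_sq).div_const 2) fun ω => ?_
        dsimp only
        nlinarith [sq_nonneg (truncAt h (Y i ω) - truncAt h (Y j ω))]
      have h3 : 0 ≤ (∫ ω, truncAt h (Y i ω) ∂μ) * ∫ ω, truncAt h (Y j ω) ∂μ :=
        mul_nonneg (integral_nonneg fun ω => truncAt_nonneg hh.le (hY0 i ω))
          (integral_nonneg fun ω => truncAt_nonneg hh.le (hY0 j ω))
      have h4 : 0 ≤ C * ρ ^ m := by positivity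
      linarith
    · rw [zero_add]
      exact (hcov i j hi hj).trans
        (mul_le_mul_of_nonneg_left (pow_le_pow_of_le_one hρ0 hρ1 (not_lt.1 hd)) hC)
  rw [ProbabilityTheory.variance_sum' fun i _ => hL i]
  have hrow : ∀ i ∈ Finset.Icc 1 n, ∑ j ∈ Finset.Icc 1 n,
      ProbabilityTheory.covariance (fun ω => truncAt h (Y i ω)) (fun ω => truncAt h (Y j ω)) μ
        ≤ (2 * m + 1) * V + n * (C * ρ ^ m) := by
    intro i hi
    calc _ ≤ ∑ j ∈ Finset.Icc 1 n, ((if Nat.dist i j < m then V else 0) + C * ρ ^ m) := by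
          refine Finset.sum_le_sum fun j hj => ?_
          rw [ProbabilityTheory.covariance_eq_sub (hL i) (hL j)]
          exact hpair i j (Finset.mem_Icc.1 hi).1 (Finset.mem_Icc.1 hj).1
      _ = (((Finset.Icc 1 n).filter fun j => Nat.dist i j < m).card : ℝ) * V
            + n * (C * ρ ^ m) := by
          rw [Finset.sum_add_distrib, ← Finset.sum_filter, Finset.sum_const, Finset.sum_const,
            Nat.card_Icc]
          simp
      _ ≤ _ := by
          gcongr
          exact_mod_cast card_filter_dist_lt_le n i m
  refine (Finset.sum_le_sum hrow).trans_eq ?_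
  rw [Finset.sum_const, Nat.card_Icc, nsmul_eq_mul, Nat.add_sub_cancel]

/-- Chebyshev bound for a sum after truncating at the two levels `h ≤ H`. -/
lemma measureReal_abs_sum_div_sub_one_le (hY : ∀ j, Measurable (Y j)) (hY0 : ∀ j ω, 0 ≤ Y j ω)
    (hident : ∀ j, 1 ≤ j → ProbabilityTheory.IdentDistrib (Y j) (Y 1) μ μ)
    {h H c ε : ℝ} (hh : 0 < h) (hH : h ≤ H) (hc : 0 < c) (hε : 0 < ε) (n : ℕ)
    (hmean : |n * (∫ ω, truncAt h (Y 1 ω) ∂μ) - c| ≤ ε / 3 * c) :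
    μ.real {ω | ε ≤ |(∑ j ∈ Finset.Icc 1 n, Y j ω) / c - 1|} ≤
      ProbabilityTheory.variance (∑ j ∈ Finset.Icc 1 n, fun ω => truncAt h (Y j ω)) μ
          / (ε / 3 * c) ^ 2
        + n * (truncMean μ (Y 1) H - truncMean μ (Y 1) h) / (ε / 3 * c)
        + n * tailProb μ (Y 1) H := by
  set T : Ω → ℝ := ∑ j ∈ Finset.Icc 1 n, fun ω => truncAt h (Y j ω) with hT
  set R : Ω → ℝ := fun ω => ∑ j ∈ Finset.Icc 1 n,
    ((if Y j ω ≤ H then Y j ω else 0) - if Y j ω ≤ h then Y j ω else 0) with hR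
  have hL : ∀ j, MemLp (fun ω => truncAt h (Y j ω)) 2 μ := fun j =>
    memLp_truncAt (hY j) (hY0 j) hh
  have hTL : MemLp T 2 μ := memLp_finsetSum' _ fun i _ => hL i
  have hδ : 0 < ε / 3 * c := by positivity
  have hTmean : ∫ ω, T ω ∂μ = n * ∫ ω, truncAt h (Y 1 ω) ∂μ := by
    have : ∀ j ∈ Finset.Icc 1 n, ∫ ω, truncAt h (Y j ω) ∂μ = ∫ ω, truncAt h (Y 1 ω) ∂μ :=
      fun j hj => ((hident j (Finset.mem_Icc.1 hj).1).comp (measurable_truncAt h)).integral_eq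
    simp only [hT, Finset.sum_apply]
    rw [integral_finsetSum _ fun j _ => (hL j).integrable one_le_two, Finset.sum_congr rfl this]
    simp
  have hRint : ∀ j, Integrable (fun ω =>
      (if Y j ω ≤ H then Y j ω else 0) - if Y j ω ≤ h then Y j ω else 0) μ := fun j =>
    (integrable_ite_le (hY j) (hY0 j) H).sub (integrable_ite_le (hY j) (hY0 j) h)
  have hid : ∀ x : ℝ, Measurable fun y : ℝ => if y ≤ x then y else 0 := fun x =>
    Measurable.ite measurableSet_Iic measurable_id measurable_const
  have hRmean : ∫ ω, R ω ∂μ = n * (truncMean μ (Y 1) H - truncMean μ (Y 1) h) := by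
    have : ∀ j ∈ Finset.Icc 1 n, ∫ ω,
        ((if Y j ω ≤ H then Y j ω else 0) - if Y j ω ≤ h then Y j ω else 0) ∂μ
          = truncMean μ (Y 1) H - truncMean μ (Y 1) h := by
      intro j hj
      rw [integral_sub (integrable_ite_le (hY j) (hY0 j) H) (integrable_ite_le (hY j) (hY0 j) h)]
      exact congrArg₂ _
        ((hident j (Finset.mem_Icc.1 hj).1).comp (hid H)).integral_eq
        ((hident j (Finset.mem_Icc.1 hj).1).comp (hid h)).integral_eq
    rw [hR, integral_finsetSum _ fun j _ => hRint j, Finset.sum_congr rfl this,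
      Finset.sum_const, Nat.card_Icc, nsmul_eq_mul, Nat.add_sub_cancel]
  have hR0 : ∀ ω, 0 ≤ R ω := by
    refine fun ω => Finset.sum_nonneg fun j _ => ?_
    have := hY0 j ω
    split_ifs <;> linarith
  have hsub : {ω | ε ≤ |(∑ j ∈ Finset.Icc 1 n, Y j ω) / c - 1|} ⊆
      ({ω | ε / 3 * c ≤ |T ω - ∫ ω, T ω ∂μ|} ∪ {ω | ε / 3 * c ≤ R ω})
        ∪ ⋃ j ∈ Finset.Icc 1 n, {ω | H < Y j ω} := by
    intro ω hω
    by_contra hcon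
    simp only [Set.mem_union, Set.mem_iUnion, Set.mem_ofPred_eq, not_or, not_exists, not_le,
      not_lt] at hcon
    obtain ⟨⟨h1, h2⟩, h3⟩ := hcon
    have hlow : T ω ≤ ∑ j ∈ Finset.Icc 1 n, Y j ω := by
      rw [hT, Finset.sum_apply]
      refine Finset.sum_le_sum fun j _ => ?_
      rcases le_total (Y j ω) h with hle | hle
      · rw [truncAt_of_le hh.le (hY0 j ω) hle]
      · rwa [truncAt_of_ge hh.le hle]
    have hup : ∑ j ∈ Finset.Icc 1 n, Y j ω ≤ T ω + R ω := by
      rw [hT, Finset.sum_apply, hR, ← Finset.sum_add_distrib]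
      refine Finset.sum_le_sum fun j hj => ?_
      have h5 := h3 j hj
      rcases le_or_gt (Y j ω) h with hle | hlt
      · rw [truncAt_of_le hh.le (hY0 j ω) hle, if_pos hle, if_pos h5]
        linarith
      · rw [truncAt_of_ge hh.le hlt.le, if_neg hlt.not_ge, if_pos h5]
        linarith
    rw [hTmean, abs_lt] at h1
    rw [abs_le] at hmean
    have hlt : |(∑ j ∈ Finset.Icc 1 n, Y j ω) / c - 1| < ε := by
      rw [div_sub_one hc.ne', abs_div, abs_of_pos hc, div_lt_iff₀ hc, abs_lt]
      constructor <;> linarith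
    exact absurd hω (not_le.2 hlt)
  have hcheb : μ.real {ω | ε / 3 * c ≤ |T ω - ∫ ω, T ω ∂μ|}
      ≤ ProbabilityTheory.variance T μ / (ε / 3 * c) ^ 2 :=
    ENNReal.toReal_le_of_le_ofReal
      (div_nonneg (ProbabilityTheory.variance_nonneg _ _) (sq_nonneg _))
      (ProbabilityTheory.meas_ge_le_variance_div_sq hTL hδ)
  have hmarkov : μ.real {ω | ε / 3 * c ≤ R ω}
      ≤ n * (truncMean μ (Y 1) H - truncMean μ (Y 1) h) / (ε / 3 * c) := by
    rw [le_div_iff₀ hδ, ← hRmean, mul_comm]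
    exact mul_meas_ge_le_integral_of_nonneg (Eventually.of_forall hR0)
      (integrable_finsetSum _ fun j _ => hRint j) _
  have htail : μ.real (⋃ j ∈ Finset.Icc 1 n, {ω | H < Y j ω}) ≤ n * tailProb μ (Y 1) H := by
    refine (measureReal_biUnion_finset_le _ _).trans_eq ?_
    have : ∀ j ∈ Finset.Icc 1 n, μ.real {ω | H < Y j ω} = tailProb μ (Y 1) H := fun j hj =>
      congrArg ENNReal.toReal
        ((hident j (Finset.mem_Icc.1 hj).1).measure_mem_eq measurableSet_Ioi)
    rw [Finset.sum_congr rfl this]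
    simp
  refine (measureReal_mono hsub).trans ((measureReal_union_le _ _).trans ?_)
  exact add_le_add ((measureReal_union_le _ _).trans (add_le_add hcheb hmarkov)) htail

end Sums

lemma tendsto_div_log_atTop : Tendsto (fun x : ℝ => x / Real.log x) atTop atTop := by
  have h := (Real.tendsto_exp_div_pow_atTop 1).comp Real.tendsto_log_atTop
  refine h.congr' ?_
  filter_upwards [eventually_gt_atTop 0] with x hx
  simp [Real.exp_log hx]

lemma pow_ceil_mul_log_mul_sq_le_one {ρ x : ℝ} (hρ0 : 0 < ρ) (hρ1 : ρ < 1) (hx : 0 < x) :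
    ρ ^ ⌈2 / (-Real.log ρ) * Real.log x⌉₊ * x ^ 2 ≤ 1 := by
  have hlog : Real.log ρ < 0 := Real.log_neg hρ0 hρ1
  have hceil : 2 * Real.log x ≤ -Real.log ρ * ⌈2 / (-Real.log ρ) * Real.log x⌉₊ := by
    have := Nat.le_ceil (2 / (-Real.log ρ) * Real.log x)
    rwa [← div_le_iff₀' (neg_pos.2 hlog), ← div_mul_eq_mul_div]
  rw [← Real.log_nonpos_iff (by positivity), Real.log_mul (by positivity) (by positivity),
    Real.log_pow, Real.log_pow]
  push_cast
  linarith

section Limits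

variable {Ω : Type*} [MeasurableSpace Ω] {μ : Measure Ω} [IsProbabilityMeasure μ] {X : Ω → ℝ}

lemma exists_pos_eventually_le_truncMean (hX : Measurable X) (hX0 : ∀ ω, 0 ≤ X ω)
    (hsv : SlowlyVarying (truncMean μ X)) : ∃ c, 0 < c ∧ ∀ᶠ x in atTop, c ≤ truncMean μ X x := by
  obtain ⟨x, hx⟩ := hsv.1.exists
  exact ⟨_, hx, (eventually_ge_atTop x).mono fun y hy => truncMean_mono hX hX0 hy⟩

/-- With `h = x / log x` and `m` of order `log x`, the variance bound for `x` truncated variables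
is `o((x ℓ(x))²)`. -/
lemma tendsto_variance_bound (hX : Measurable X) (hX0 : ∀ ω, 0 ≤ X ω)
    (hsv : SlowlyVarying (truncMean μ X))
    (hlog : Tendsto (fun x => truncMean μ X (x / Real.log x) / truncMean μ X x) atTop (𝓝 1))
    {C ρ : ℝ} (hC : 0 < C) (hρ0 : 0 < ρ) (hρ1 : ρ < 1) :
    Tendsto (fun x : ℝ => x * ((2 * (⌈2 / (-Real.log ρ) * Real.log x⌉₊ : ℝ) + 1)
        * (∫ ω, truncAt (x / Real.log x) (X ω) ^ 2 ∂μ)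
        + x * (C * (x / Real.log x) ^ 2 * ρ ^ ⌈2 / (-Real.log ρ) * Real.log x⌉₊))
        / (x * truncMean μ X x) ^ 2) atTop (𝓝 0) := by
  obtain ⟨c, hc, hcev⟩ := exists_pos_eventually_le_truncMean hX hX0 hsv
  set K := 2 / (-Real.log ρ) with hK
  have hK0 : 0 < K := div_pos two_pos (neg_pos.2 (Real.log_neg hρ0 hρ1))
  have hinv : Tendsto (fun x : ℝ => (Real.log x)⁻¹) atTop (𝓝 0) :=
    tendsto_inv_atTop_zero.comp Real.tendsto_log_atTop
  have hv := (tendsto_integral_sq_truncAt_div hX hX0 hsv).comp tendsto_div_log_atTop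
  have hlim : Tendsto (fun x : ℝ => (2 * K + 3 * (Real.log x)⁻¹)
      * ((∫ ω, truncAt (x / Real.log x) (X ω) ^ 2 ∂μ)
        / (x / Real.log x * truncMean μ X (x / Real.log x)))
      * (truncMean μ X (x / Real.log x) / truncMean μ X x) / c
      + C / c ^ 2 * (Real.log x)⁻¹ ^ 2) atTop
      (𝓝 ((2 * K + 3 * 0) * 0 * 1 / c + C / c ^ 2 * 0 ^ 2)) :=
    ((((((hinv.const_mul 3).const_add _).mul hv).mul hlog).div_const c).add
      ((hinv.pow 2).const_mul _))
  simp only [mul_zero, zero_mul, zero_div, zero_add, ne_eq, OfNat.ofNat_ne_zero,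
    not_false_eq_true, zero_pow] at hlim
  refine squeeze_zero' ?_ ?_ hlim
  · filter_upwards [eventually_gt_atTop 0] with x hx
    have : 0 ≤ ∫ ω, truncAt (x / Real.log x) (X ω) ^ 2 ∂μ := integral_nonneg fun ω => sq_nonneg _
    positivity
  · filter_upwards [eventually_gt_atTop 1, hcev, tendsto_div_log_atTop.eventually hcev]
      with x hx hLc hLhc
    have hx0 : 0 < x := by linarith
    have hl : 0 < Real.log x := Real.log_pos hx
    have hV : 0 ≤ ∫ ω, truncAt (x / Real.log x) (X ω) ^ 2 ∂μ :=
      integral_nonneg fun ω => sq_nonneg _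
    have hm : (⌈K * Real.log x⌉₊ : ℝ) ≤ K * Real.log x + 1 :=
      (Nat.ceil_lt_add_one (by positivity)).le
    have hpow := pow_ceil_mul_log_mul_sq_le_one hρ0 hρ1 hx0
    rw [← hK] at hpow
    set m := ⌈K * Real.log x⌉₊
    set V := ∫ ω, truncAt (x / Real.log x) (X ω) ^ 2 ∂μ
    set L := truncMean μ X x
    set Lh := truncMean μ X (x / Real.log x)
    have hL : 0 < L := hc.trans_le hLc
    have hLh : 0 < Lh := hc.trans_le hLhc
    calc x * ((2 * (m : ℝ) + 1) * V + x * (C * (x / Real.log x) ^ 2 * ρ ^ m)) / (x * L) ^ 2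
        = x * ((2 * (m : ℝ) + 1) * V) / (x * L) ^ 2
          + C * (x / Real.log x) ^ 2 * (ρ ^ m * x ^ 2) / (x * L) ^ 2 := by ring
      _ ≤ x * ((2 * (K * Real.log x + 1) + 1) * V) / (x * L) ^ 2
          + C * (x / Real.log x) ^ 2 * 1 / (x * L) ^ 2 := by gcongr
      _ = (2 * K + 3 * (Real.log x)⁻¹) * (V / (x / Real.log x * Lh)) * (Lh / L) / L
          + C / L ^ 2 * (Real.log x)⁻¹ ^ 2 := by
        field_simp
        ring
      _ ≤ _ := by gcongr

end Limits


/-- A general weak law of large numbers under a one-sided covariance bound for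
truncations: `(Y_1 + ⋯ + Y_n)/(n ℓ(n)) → 1` in probability. -/
theorem general_wlln
    {Ω : Type*} [MeasurableSpace Ω] (μ : Measure Ω) [IsProbabilityMeasure μ]
    (Y : ℕ → Ω → ℝ) (ℓ : ℝ → ℝ) (η h₀ Cb : ℝ)
    (hY : ∀ j, Measurable (Y j))
    (hY0 : ∀ j ω, 0 ≤ Y j ω)
    (hident : ∀ j : ℕ, 1 ≤ j → Measure.map (Y j) μ = Measure.map (Y 1) μ)
    (hℓdef : ∀ x : ℝ, ℓ x = ∫ ω, (if Y 1 ω ≤ x then Y 1 ω else 0) ∂μ)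
    (hℓ : SlowlyVarying ℓ)
    (hℓa : Filter.Tendsto (fun x : ℝ => ℓ (x * ℓ x) / ℓ x) Filter.atTop (nhds 1))
    (hℓb : Filter.Tendsto (fun x : ℝ => ℓ (x / Real.log x) / ℓ x) Filter.atTop (nhds 1))
    (hη0 : 0 ≤ η) (hη1 : η < 1) (hh₀ : 0 < h₀) (hCb : 0 < Cb)
    (hcov : ∀ i j : ℕ, 1 ≤ i → 1 ≤ j → ∀ h : ℝ, h₀ ≤ h →
      (∫ ω, truncAt h (Y i ω) * truncAt h (Y j ω) ∂μ) -
        (∫ ω, truncAt h (Y i ω) ∂μ) * ∫ ω, truncAt h (Y j ω) ∂μ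
        ≤ Cb * h ^ 2 * η ^ (Nat.dist i j)) :
    TendstoInMeasure μ
      (fun n : ℕ => fun ω => (∑ j ∈ Finset.Icc 1 n, Y j ω) / ((n : ℝ) * ℓ n))
      Filter.atTop (fun _ => (1 : ℝ)) := by
  obtain rfl : ℓ = truncMean μ (Y 1) := funext hℓdef
  have hid : ∀ j, 1 ≤ j → ProbabilityTheory.IdentDistrib (Y j) (Y 1) μ μ := fun j hj =>
    ⟨(hY j).aemeasurable, (hY 1).aemeasurable, hident j hj⟩
  set ρ := max η (1 / 2)
  have hρ0 : 0 < ρ := lt_max_of_lt_right one_half_pos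
  have hρ1 : ρ < 1 := max_lt hη1 one_half_lt_one
  obtain ⟨c, hc, hcev⟩ := exists_pos_eventually_le_truncMean (hY 1) (hY0 1) hℓ
  have hHtop : Tendsto (fun x => x * truncMean μ (Y 1) x) atTop atTop := by
    refine tendsto_atTop_mono' _ ?_ (tendsto_id.atTop_mul_const hc)
    filter_upwards [hcev, eventually_ge_atTop 0] with x hx hx0
    exact mul_le_mul_of_nonneg_left hx hx0
  have hmean : Tendsto (fun x => (∫ ω, truncAt (x / Real.log x) (Y 1 ω) ∂μ) / truncMean μ (Y 1) x)
      atTop (𝓝 1) := by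
    have h := ((tendsto_integral_truncAt_div (hY 1) (hY0 1) hℓ).comp tendsto_div_log_atTop).mul hℓb
    rw [one_mul] at h
    refine h.congr' ?_
    filter_upwards [tendsto_div_log_atTop.eventually hℓ.1] with x hx
    exact div_mul_div_cancel₀ hx.ne'
  have htail : Tendsto (fun x => x * tailProb μ (Y 1) (x * truncMean μ (Y 1) x)) atTop (𝓝 0) := by
    have h := ((tendsto_mul_tailProb_div_truncMean (hY 1) (hY0 1) hℓ).comp hHtop).mul hℓa
    rw [zero_mul] at h
    refine h.congr' ?_
    filter_upwards [hHtop.eventually hℓ.1, hℓ.1] with x hx hx'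
    have h1 : truncMean μ (Y 1) (x * truncMean μ (Y 1) x) ≠ 0 := hx.ne'
    have h2 : truncMean μ (Y 1) x ≠ 0 := hx'.ne'
    simp only [Function.comp_apply]
    field_simp
  have hvar := tendsto_variance_bound (hY 1) (hY0 1) hℓ hℓb hCb hρ0 hρ1
  rw [tendstoInMeasure_iff_measureReal_dist]
  intro ε hε
  have hlim := ((hvar.const_mul (9 / ε ^ 2)).add ((hℓa.sub hℓb).const_mul (3 / ε))).add htail
  rw [sub_self, mul_zero, mul_zero, add_zero, add_zero] at hlim
  refine squeeze_zero' (Eventually.of_forall fun n => measureReal_nonneg) ?_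
    (hlim.comp tendsto_natCast_atTop_atTop)
  have hevx : ∀ᶠ x : ℝ in atTop, 1 < x ∧ 0 < truncMean μ (Y 1) x ∧ h₀ ≤ x / Real.log x ∧
      x / Real.log x ≤ x * truncMean μ (Y 1) x ∧
      |(∫ ω, truncAt (x / Real.log x) (Y 1 ω) ∂μ) / truncMean μ (Y 1) x - 1| ≤ ε / 3 := by
    filter_upwards [eventually_gt_atTop 1, hcev,
      tendsto_div_log_atTop.eventually (eventually_ge_atTop h₀),
      Real.tendsto_log_atTop.eventually (eventually_ge_atTop c⁻¹),
      hmean.eventually (Metric.closedBall_mem_nhds 1 (show 0 < ε / 3 by positivity))]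
      with x h1 h2 h3 h4 h5
    refine ⟨h1, hc.trans_le h2, h3, ?_, h5⟩
    rw [div_eq_mul_inv]
    exact mul_le_mul_of_nonneg_left ((inv_le_of_inv_le₀ hc h4).trans h2) (by linarith)
  filter_upwards [tendsto_natCast_atTop_atTop.eventually hevx] with n ⟨h1, h2, h3, h4, h5⟩
  have hn0 : (0 : ℝ) < n := by linarith
  have hh : 0 < (n : ℝ) / Real.log n := hh₀.trans_le h3
  have hc' : 0 < (n : ℝ) * truncMean μ (Y 1) n := mul_pos hn0 h2
  have hcov' : ∀ i j : ℕ, 1 ≤ i → 1 ≤ j →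
      (∫ ω, truncAt (n / Real.log n) (Y i ω) * truncAt (n / Real.log n) (Y j ω) ∂μ) -
        (∫ ω, truncAt (n / Real.log n) (Y i ω) ∂μ) * ∫ ω, truncAt (n / Real.log n) (Y j ω) ∂μ
        ≤ Cb * (n / Real.log n) ^ 2 * ρ ^ (Nat.dist i j) := by
    intro i j hi hj
    refine (hcov i j hi hj _ h3).trans ?_
    gcongr
    exact le_max_left _ _
  have hV := variance_sum_truncAt_le hY hY0 hid hh (by positivity) hρ0.le hρ1.le hcov' n
    ⌈2 / (-Real.log ρ) * Real.log n⌉₊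
  have hmean' : |n * (∫ ω, truncAt (n / Real.log n) (Y 1 ω) ∂μ) - n * truncMean μ (Y 1) n|
      ≤ ε / 3 * (n * truncMean μ (Y 1) n) := by
    rw [div_sub_one h2.ne', abs_div, abs_of_pos h2, div_le_iff₀ h2] at h5
    rw [← mul_sub, abs_mul, abs_of_pos hn0]
    nlinarith
  simp only [Real.dist_eq]
  refine (measureReal_abs_sum_div_sub_one_le hY hY0 hid hh h4 hc' hε n hmean').trans ?_
  simp only [Function.comp_apply]
  refine add_le_add_left (add_le_add ?_ (le_of_eq ?_)) _
  · refine (div_le_div_of_nonneg_right hV (sq_nonneg _)).trans_eq ?_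
    field_simp
    ring
  · field_simp
end
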